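/- Assume d ≥ 3, Ω is irreducible, and the torsion-free group Γ divides Ω. If some flat of Ω is not isolated, then every point of Ω lies in some flat of Ω (i.e. Ω is foliated by flats). -/

import Mathlib

open Set Filter Metric

noncomputable section

/-- `ℝ^d`. -/
abbrev Euc (d : ℕ) := EuclideanSpace ℝ (Fin d)

/-- A flat of `Ω` with prescribed vertices `v`. -/
def IsFlatWith {d : ℕ} (Ω : Set (Euc d)) (v : Fin d → Euc d) : Prop :=
  AffineIndependent ℝ v ∧
  (∀ j, v j ∈ closure Ω \ Ω) ∧
  intrinsicInterior ℝ (convexHull ℝ (Set.range v)) ⊆ Ω ∧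
  convexHull ℝ (Set.range v) \ intrinsicInterior ℝ (convexHull ℝ (Set.range v)) ⊆ closure Ω \ Ω

/-- A (codimension-one, properly embedded) flat of `Ω`. -/
def IsFlat {d : ℕ} (Ω : Set (Euc d)) (F : Set (Euc d)) : Prop :=
  ∃ v : Fin d → Euc d, IsFlatWith Ω v ∧ F = intrinsicInterior ℝ (convexHull ℝ (Set.range v))

/-- The cone over a subset of `ℝ^d`, inside `ℝ^d × ℝ ≅ ℝ^{d+1}`. -/
def coneOver {d : ℕ} (S : Set (Euc d)) : Set (Euc d × ℝ) :=
  {p | ∃ t : ℝ, 0 < t ∧ ∃ x ∈ S, p = t • (x, (1 : ℝ))}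

/-- Irreducibility of a properly convex domain: its cone admits no direct-sum
decomposition into convex cones. -/
def IsIrreducibleDomain {d : ℕ} (Ω : Set (Euc d)) : Prop :=
  ¬ ∃ (V₁ V₂ : Submodule ℝ (Euc d × ℝ)) (C₁ C₂ : Set (Euc d × ℝ)),
      V₁ ≠ ⊥ ∧ V₂ ≠ ⊥ ∧ V₁ ≠ ⊤ ∧ V₂ ≠ ⊤ ∧ IsCompl V₁ V₂ ∧
      C₁ ⊆ (V₁ : Set (Euc d × ℝ)) ∧ C₂ ⊆ (V₂ : Set (Euc d × ℝ)) ∧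
      Convex ℝ C₁ ∧ Convex ℝ C₂ ∧
      (∀ t : ℝ, 0 < t → ∀ c ∈ C₁, t • c ∈ C₁) ∧
      (∀ t : ℝ, 0 < t → ∀ c ∈ C₂, t • c ∈ C₂) ∧
      coneOver Ω = {p | ∃ c₁ ∈ C₁, ∃ c₂ ∈ C₂, p = c₁ + c₂}

/-- The homeomorphism of `Ω` induced by a linear automorphism of `ℝ^{d+1}`
preserving the cone over `Ω`. -/
def projAct {d : ℕ} (g : (Euc d × ℝ) ≃ₗ[ℝ] (Euc d × ℝ)) (x : Euc d) : Euc d :=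
  ((g (x, 1)).2)⁻¹ • (g (x, 1)).1

/-- `Γ` divides `Ω`: every element preserves the cone over `Ω`; the induced action on `Ω`
is free and properly discontinuous, and admits a compact set whose translates cover `Ω`. -/
def Divides {d : ℕ} (Ω : Set (Euc d))
    (Γ : Subgroup ((Euc d × ℝ) ≃ₗ[ℝ] (Euc d × ℝ))) : Prop :=
  (∀ γ ∈ Γ, (γ : (Euc d × ℝ) ≃ₗ[ℝ] (Euc d × ℝ)) '' coneOver Ω = coneOver Ω) ∧
  (∀ γ ∈ Γ, γ ≠ 1 → ∀ x ∈ Ω, projAct γ x ≠ x) ∧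
  (∀ K : Set (Euc d), K ⊆ Ω → IsCompact K →
    {γ : (Euc d × ℝ) ≃ₗ[ℝ] (Euc d × ℝ) | γ ∈ Γ ∧ (projAct γ '' K ∩ K).Nonempty}.Finite) ∧
  (∃ K : Set (Euc d), K ⊆ Ω ∧ IsCompact K ∧ (⋃ γ ∈ Γ, projAct γ '' K) = Ω)

/-- `Γ` is torsion-free. -/
def TorsionFreeSub {d : ℕ} (Γ : Subgroup ((Euc d × ℝ) ≃ₗ[ℝ] (Euc d × ℝ))) : Prop :=
  ∀ γ ∈ Γ, ∀ n : ℕ, n ≠ 0 → γ ^ n = 1 → γ = 1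

/-- Convergence of a sequence of flats: Hausdorff convergence of their closures. -/
def FlatsConverge {d : ℕ} (Fs : ℕ → Set (Euc d)) (F : Set (Euc d)) : Prop :=
  Tendsto (fun i => hausdorffDist (closure (Fs i)) (closure F)) atTop (nhds 0)

/-- A flat is isolated if no sequence of flats, all distinct from it, converges to it. -/
def IsIsolatedFlat {d : ℕ} (Ω F : Set (Euc d)) : Prop :=
  ¬ ∃ Fs : ℕ → Set (Euc d), (∀ i, IsFlat Ω (Fs i)) ∧ (∀ i, Fs i ≠ F) ∧ FlatsConverge Fs F

/-- The union of all flats of `Ω`. -/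
def flatsUnion {d : ℕ} (Ω : Set (Euc d)) : Set (Euc d) := ⋃₀ {F | IsFlat Ω F}

/-- A boundary flat: a flat contained in the closure of a connected component of the
complement of the union of all flats. -/
def IsBoundaryFlat {d : ℕ} (Ω F : Set (Euc d)) : Prop :=
  IsFlat Ω F ∧ ∃ x ∈ Ω \ flatsUnion Ω,
    F ⊆ closure (connectedComponentIn (Ω \ flatsUnion Ω) x)

section ConeGeometry

variable {V : Type*} [NormedAddCommGroup V] [NormedSpace ℝ V]

/-- `C` is a nonempty open convex cone on which the functional `m` dominates the norm. -/
structure IsProperCone (C : Set V) (m : V →L[ℝ] ℝ) : Prop where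
  isOpen : IsOpen C
  nonempty : C.Nonempty
  add_mem : ∀ x ∈ C, ∀ y ∈ C, x + y ∈ C
  smul_mem : ∀ t : ℝ, 0 < t → ∀ x ∈ C, t • x ∈ C
  zero_notMem : (0 : V) ∉ C
  norm_le : ∀ x ∈ C, ‖x‖ ≤ m x

namespace IsProperCone

variable {C : Set V} {m : V →L[ℝ] ℝ}

theorem closure_add (hC : IsProperCone C m) {x y : V} (hx : x ∈ closure C) (hy : y ∈ closure C) :
    x + y ∈ closure C :=
  map_mem_closure₂ continuous_add hx hy hC.add_mem

theorem add_mem_of_closure (hC : IsProperCone C m) {x y : V} (hx : x ∈ closure C) (hy : y ∈ C) :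
    x + y ∈ C := by
  have hU : {z : V | y + x - z ∈ C} ∈ nhds x :=
    (hC.isOpen.preimage (by fun_prop : Continuous fun z : V => y + x - z)).mem_nhds (by simpa)
  obtain ⟨z, hz, hzC⟩ := mem_closure_iff_nhds.1 hx _ hU
  have := hC.add_mem _ hzC _ hz
  convert this using 1
  abel

theorem zero_mem_closure (hC : IsProperCone C m) : (0 : V) ∈ closure C := by
  obtain ⟨c, hc⟩ := hC.nonempty
  have h : Tendsto (fun t : ℝ => t • c) (nhdsWithin 0 (Ioi 0)) (nhds ((0 : ℝ) • c)) :=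
    ((continuous_id.smul continuous_const).tendsto 0).mono_left nhdsWithin_le_nhds
  rw [zero_smul] at h
  exact mem_closure_of_tendsto h
    (eventually_nhdsWithin_of_forall fun t ht => hC.smul_mem t ht c hc)

theorem closure_smul (hC : IsProperCone C m) {t : ℝ} (ht : 0 ≤ t) {x : V} (hx : x ∈ closure C) :
    t • x ∈ closure C := by
  rcases ht.eq_or_lt with rfl | ht
  · simpa using hC.zero_mem_closure
  · exact map_mem_closure (continuous_const_smul t) hx fun y hy => hC.smul_mem t ht y hy

theorem closure_sum (hC : IsProperCone C m) {ι : Type*} (s : Finset ι) (f : ι → V)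
    (hf : ∀ i ∈ s, f i ∈ closure C) : ∑ i ∈ s, f i ∈ closure C := by
  classical
  induction s using Finset.induction_on with
  | empty => simpa using hC.zero_mem_closure
  | insert a s ha ih =>
    rw [Finset.sum_insert ha]
    exact hC.closure_add (hf _ (by simp)) (ih fun i hi => hf i (by simp [hi]))

theorem norm_le_closure (hC : IsProperCone C m) {x : V} (hx : x ∈ closure C) : ‖x‖ ≤ m x :=
  (isClosed_le continuous_norm m.continuous).closure_subset_iff.2 hC.norm_le hx

theorem nonneg_closure (hC : IsProperCone C m) {x : V} (hx : x ∈ closure C) : 0 ≤ m x :=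
  (norm_nonneg x).trans (hC.norm_le_closure hx)

theorem ne_zero (hC : IsProperCone C m) {x : V} (hx : x ∈ C) : x ≠ 0 := by
  rintro rfl
  exact hC.zero_notMem hx

theorem pos_closure (hC : IsProperCone C m) {x : V} (hx : x ∈ closure C) (h0 : x ≠ 0) : 0 < m x :=
  (norm_pos_iff.2 h0).trans_le (hC.norm_le_closure hx)

theorem pos (hC : IsProperCone C m) {x : V} (hx : x ∈ C) : 0 < m x :=
  hC.pos_closure (subset_closure hx) (hC.ne_zero hx)

theorem nonneg_of_closure {τ : V →L[ℝ] ℝ} (hτ : ∀ x ∈ C, 0 ≤ τ x) {x : V}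
    (hx : x ∈ closure C) : 0 ≤ τ x :=
  (isClosed_le continuous_const τ.continuous).closure_subset_iff.2 hτ hx

theorem combo_mem (hC : IsProperCone C m) {x y : V} (hx : x ∈ C) (hy : y ∈ C) {s : ℝ}
    (h0 : 0 ≤ s) (h1 : s ≤ 1) : (1 - s) • x + s • y ∈ C := by
  rcases h0.eq_or_lt with rfl | h0
  · simpa
  · exact hC.add_mem_of_closure (hC.closure_smul (by linarith) (subset_closure hx))
      (hC.smul_mem s h0 y hy)

/-- A functional supporting the cone at a point outside of it. -/
theorem exists_support (hC : IsProperCone C m) {x : V} (hx : x ∈ closure C) (hxC : x ∉ C) :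
    ∃ τ : V →L[ℝ] ℝ, τ x = 0 ∧ (∀ y ∈ C, 0 < τ y) := by
  have hconv : Convex ℝ C := by
    intro y hy z hz a b ha hb hab
    have := hC.combo_mem hy hz hb (by linarith)
    rwa [← hab, add_sub_cancel_right] at this
  obtain ⟨τ, hτ⟩ := geometric_hahn_banach_point_open hconv hC.isOpen hxC
  have key : ∀ y ∈ C, 0 ≤ τ y := by
    intro y hy
    by_contra! h
    have hpos : 0 < |τ x| + 1 := by positivity
    have h1 := hτ _ (hC.smul_mem ((|τ x| + 1) / (- τ y)) (div_pos hpos (by linarith)) y hy)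
    rw [map_smul, smul_eq_mul, div_mul_eq_mul_div, div_neg, mul_div_assoc, div_self h.ne] at h1
    have := neg_abs_le (τ x)
    linarith
  have h0 : τ x ≤ 0 := by
    have : (0 : V) ∈ {y | τ x ≤ τ y} :=
      (isClosed_le continuous_const τ.continuous).closure_subset_iff.2
        (fun y hy => (hτ y hy).le) hC.zero_mem_closure
    simpa using this
  have h1 : τ x = 0 := le_antisymm h0 (nonneg_of_closure key hx)
  exact ⟨τ, h1, fun y hy => h1 ▸ hτ y hy⟩

/-- Small perturbations of a point of the cone stay in the cone. -/
theorem exists_pos_forall_add_smul_mem (hC : IsProperCone C m) {x : V} (hx : x ∈ C) (v : V) :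
    ∃ ε > 0, ∀ t : ℝ, |t| < ε → x + t • v ∈ C := by
  have h : ∀ᶠ t : ℝ in nhds 0, x + t • v ∈ C :=
    (hC.isOpen.preimage (by fun_prop : Continuous fun t : ℝ => x + t • v)).mem_nhds (by simpa)
  obtain ⟨ε, hε, h⟩ := Metric.eventually_nhds_iff.1 h
  exact ⟨ε, hε, fun t ht => h (by simpa using ht)⟩

end IsProperCone

/-- A direct-sum decomposition of a cone into convex cones. -/
def IsDecomposable (C : Set V) : Prop :=
  ∃ (V₁ V₂ : Submodule ℝ V) (C₁ C₂ : Set V),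
      V₁ ≠ ⊥ ∧ V₂ ≠ ⊥ ∧ V₁ ≠ ⊤ ∧ V₂ ≠ ⊤ ∧ IsCompl V₁ V₂ ∧
      C₁ ⊆ (V₁ : Set V) ∧ C₂ ⊆ (V₂ : Set V) ∧
      Convex ℝ C₁ ∧ Convex ℝ C₂ ∧
      (∀ t : ℝ, 0 < t → ∀ c ∈ C₁, t • c ∈ C₁) ∧
      (∀ t : ℝ, 0 < t → ∀ c ∈ C₂, t • c ∈ C₂) ∧
      C = {p | ∃ c₁ ∈ C₁, ∃ c₂ ∈ C₂, p = c₁ + c₂}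

/-- A torsion-free group of linear automorphisms dividing the cone `C`. -/
structure DividesCone (C : Set V) (Γ : Subgroup (V ≃ₗ[ℝ] V)) : Prop where
  map_mem : ∀ γ ∈ Γ, ∀ x ∈ C, γ x ∈ C
  cocompact : ∃ K ⊆ C, IsCompact K ∧ ∀ x ∈ C, ∃ γ ∈ Γ, ∃ s : ℝ, 0 < s ∧ s • γ x ∈ K
  proper : ∀ K ⊆ C, IsCompact K →
    {γ : V ≃ₗ[ℝ] V | γ ∈ Γ ∧ ∃ x ∈ K, ∃ s : ℝ, 0 < s ∧ s • γ x ∈ K}.Finite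
  torsionFree : ∀ γ ∈ Γ, ∀ n : ℕ, n ≠ 0 → γ ^ n = 1 → γ = 1

theorem IsProperCone.convex {C : Set V} {m : V →L[ℝ] ℝ} (hC : IsProperCone C m) : Convex ℝ C := by
  intro y hy z hz a b ha hb hab
  have := hC.combo_mem hy hz hb (by linarith)
  rwa [← hab, add_sub_cancel_right] at this

/-- If maps `g n`, carrying the stretched cones `(v - π v) + t n • π v ∈ C` onto `C`, converge to an
invertible map, then the cone `C` is decomposable. -/
theorem isDecomposable_of_tendsto [FiniteDimensional ℝ V] {C : Set V} {m : V →L[ℝ] ℝ}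
    (hC : IsProperCone C m) (π : V →L[ℝ] V) (hπ : ∀ v, π (π v) = π v)
    {p : V} (hp0 : p ≠ 0) (hp : π p = 0) {ε : ℝ} (hε : 0 < ε)
    (hrel : ∀ v, π v = 0 → ‖v‖ < ε → p + v ∈ closure C) (hπ0 : ∃ v, π v ≠ 0)
    (t : ℕ → ℝ) (ht0 : ∀ n, 0 < t n) (ht : Tendsto t atTop (nhds 0))
    (g : ℕ → V →L[ℝ] V) (G : V →L[ℝ] V) (hG : Function.Injective G)
    (hgG : Tendsto g atTop (nhds G))
    (hg : ∀ n v, g n v ∈ C ↔ (v - π v) + t n • π v ∈ C) : IsDecomposable C := by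
  have hgv : ∀ v, Tendsto (fun n => g n v) atTop (nhds (G v)) := fun v =>
    ((ContinuousLinearMap.apply ℝ V v).continuous.tendsto G).comp hgG
  have hev : ∀ q, G q ∈ C → ∀ᶠ n in atTop, (q - π q) + t n • π q ∈ C := by
    intro q hq
    filter_upwards [(hgv q).eventually (hC.isOpen.mem_nhds hq)] with n hn using (hg n q).1 hn
  have hfirst : ∀ q, G q ∈ C → q - π q ∈ closure C := by
    intro q hq
    have : Tendsto (fun n => (q - π q) + t n • π q) atTop (nhds ((q - π q) + (0 : ℝ) • π q)) :=
      tendsto_const_nhds.add (ht.smul_const _)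
    rw [zero_smul, add_zero] at this
    exact mem_closure_of_tendsto this (hev q hq)
  have hsecond : ∀ q, G q ∈ C → ∃ δ : ℝ, 0 < δ ∧ p + δ • π q ∈ closure C := by
    intro q hq
    obtain ⟨N, hN⟩ := (hev q hq).exists
    obtain ⟨δ, hδ, hδ'⟩ : ∃ δ : ℝ, 0 < δ ∧ δ * ‖q - π q‖ < ε := by
      refine ⟨ε / (‖q - π q‖ + 1), by positivity, ?_⟩
      rw [div_mul_eq_mul_div, div_lt_iff₀ (by positivity)]
      nlinarith [norm_nonneg (q - π q)]
    refine ⟨δ * t N, mul_pos hδ (ht0 N), ?_⟩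
    have h1 : p + (-δ) • (q - π q) ∈ closure C := by
      refine hrel _ (by simp [hπ]) ?_
      rwa [norm_smul, norm_neg, Real.norm_of_nonneg hδ.le]
    have h2 := hC.closure_add h1 (hC.closure_smul hδ.le (subset_closure hN))
    convert h2 using 1
    module
  have hmix : ∀ q q', G q ∈ C → G q' ∈ C → G ((q - π q) + π q') ∈ closure C := by
    intro q q' hq hq'
    obtain ⟨δ, hδ, hδ'⟩ := hsecond q' hq'
    have hpC : p ∈ closure C := by simpa using hrel 0 (by simp) (by simpa)
    have hη : ∀ η > 0, G ((q - π q) + π q' + (η : ℝ) • (p + q)) ∈ closure C := by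
      intro η hη
      refine mem_closure_of_tendsto (hgv _) ?_
      filter_upwards [hev q hq, ht.eventually_le_const (mul_pos hη hδ)] with n hn hn'
      rw [hg]
      have e : (q - π q + π q' + η • (p + q) - π (q - π q + π q' + η • (p + q))) +
          t n • π (q - π q + π q' + η • (p + q)) =
          ((q - π q) + ((η - t n / δ) • p + (t n / δ) • (p + δ • π q'))) +
            η • ((q - π q) + t n • π q) := by
        have : (t n / δ) • (p + δ • π q') = (t n / δ) • p + t n • π q' := by
          rw [smul_add, smul_smul, div_mul_cancel₀ _ hδ.ne']
        rw [this]
        simp only [map_add, map_sub, map_smul, hπ, hp]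
        module
      rw [e]
      refine hC.add_mem_of_closure (hC.closure_add (hfirst q hq) (hC.closure_add ?_ ?_))
        (hC.smul_mem η hη _ hn)
      · refine hC.closure_smul ?_ hpC
        rw [sub_nonneg, div_le_iff₀ hδ]
        exact hn'
      · exact hC.closure_smul (div_nonneg (ht0 n).le hδ.le) hδ'
    have hlim : Tendsto (fun η : ℝ => G ((q - π q) + π q' + η • (p + q)))
        (nhdsWithin 0 (Ioi 0)) (nhds (G ((q - π q) + π q' + (0 : ℝ) • (p + q)))) :=
      ((by fun_prop : Continuous fun η : ℝ => G ((q - π q) + π q' + η • (p + q))).tendsto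
        0).mono_left nhdsWithin_le_nhds
    rw [zero_smul, add_zero] at hlim
    have := mem_closure_of_tendsto hlim (eventually_nhdsWithin_of_forall hη)
    rwa [closure_closure] at this
  have hsplit : ∀ q q', G q ∈ C → G q' ∈ C → G ((q - π q) + π q') ∈ C := by
    intro q q' hq hq'
    obtain ⟨a, ha, ha'⟩ := hC.exists_pos_forall_add_smul_mem hq (G (q + q'))
    obtain ⟨b, hb, hb'⟩ := hC.exists_pos_forall_add_smul_mem hq' (G (q + q'))
    have hc : 0 < min a b / 2 := half_pos (lt_min ha hb)
    have hca : min a b / 2 < a := (half_lt_self (lt_min ha hb)).trans_le (min_le_left _ _)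
    have hcb : min a b / 2 < b := (half_lt_self (lt_min ha hb)).trans_le (min_le_right _ _)
    set c := min a b / 2
    have h1 := ha' (-c) (by rwa [abs_neg, abs_of_pos hc])
    have h2 := hb' (-c) (by rwa [abs_neg, abs_of_pos hc])
    rw [← map_smul, ← map_add] at h1 h2
    have h3 := hmix _ _ h1 h2
    have h4 : G (c • (q + q')) ∈ C := by
      rw [map_smul, map_add]
      exact hC.smul_mem c hc _ (hC.add_mem _ hq _ hq')
    have h5 := hC.add_mem_of_closure h3 h4
    rw [← map_add] at h5
    convert h5 using 2
    simp only [map_add, map_smul]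
    module
  let E : V ≃ₗ[ℝ] V := LinearEquiv.ofInjectiveEndo (G : V →ₗ[ℝ] V) hG
  have hE : ∀ v, E v = G v := fun v => rfl
  have hsurj : Function.Surjective G := fun v => ⟨E.symm v, by rw [← hE, E.apply_symm_apply]⟩
  have hcompl : IsCompl (LinearMap.ker (π : V →ₗ[ℝ] V)) (LinearMap.range (π : V →ₗ[ℝ] V)) := by
    constructor
    · rw [Submodule.disjoint_def]
      rintro x hx ⟨y, rfl⟩
      have hx' : π (π y) = 0 := hx
      rwa [hπ] at hx'
    · rw [Submodule.codisjoint_iff_exists_add_eq]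
      intro v
      exact ⟨v - π v, π v, by simp [hπ], ⟨v, rfl⟩, by simp⟩
  have hcompl' := (Submodule.orderIsoMapComap E).isCompl hcompl
  simp only [Submodule.orderIsoMapComap_apply] at hcompl'
  have hconv : Convex ℝ {q | G q ∈ C} := hC.convex.linear_preimage (G : V →ₗ[ℝ] V)
  have hb1 : (LinearMap.ker (π : V →ₗ[ℝ] V)).map (E : V →ₗ[ℝ] V) ≠ ⊥ := by
    intro h
    rw [Submodule.map_eq_bot_iff] at h
    exact hp0 ((Submodule.mem_bot ℝ).1 (h ▸ (show p ∈ LinearMap.ker (π : V →ₗ[ℝ] V) from hp)))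
  have hb2 : (LinearMap.range (π : V →ₗ[ℝ] V)).map (E : V →ₗ[ℝ] V) ≠ ⊥ := by
    obtain ⟨v, hv⟩ := hπ0
    intro h
    rw [Submodule.map_eq_bot_iff, LinearMap.range_eq_bot] at h
    exact hv (by simpa using LinearMap.congr_fun h v)
  refine ⟨_, _, (G.comp (ContinuousLinearMap.id ℝ V - π)) '' {q | G q ∈ C},
    (G.comp π) '' {q | G q ∈ C}, hb1, hb2, fun h => hb2 (top_disjoint.1 (h ▸ hcompl'.disjoint)),
    fun h => hb1 (disjoint_top.1 (h ▸ hcompl'.disjoint)), hcompl', ?_, ?_,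
    hconv.linear_image ((G.comp (ContinuousLinearMap.id ℝ V - π) : V →L[ℝ] V) : V →ₗ[ℝ] V),
    hconv.linear_image ((G.comp π : V →L[ℝ] V) : V →ₗ[ℝ] V), ?_, ?_, ?_⟩
  · rintro _ ⟨q, -, rfl⟩
    exact ⟨q - π q, by simp [hπ], rfl⟩
  · rintro _ ⟨q, -, rfl⟩
    exact ⟨π q, ⟨q, rfl⟩, rfl⟩
  · rintro s hs _ ⟨q, hq, rfl⟩
    refine ⟨s • q, ?_, by simp⟩
    simpa using hC.smul_mem s hs _ hq
  · rintro s hs _ ⟨q, hq, rfl⟩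
    refine ⟨s • q, ?_, by simp⟩
    simpa using hC.smul_mem s hs _ hq
  · ext c
    constructor
    · intro hc
      obtain ⟨q, rfl⟩ := hsurj c
      refine ⟨_, ⟨q, hc, rfl⟩, _, ⟨q, hc, rfl⟩, by simp⟩
    · rintro ⟨_, ⟨q, hq, rfl⟩, _, ⟨q', hq', rfl⟩, rfl⟩
      have := hsplit q q' hq hq'
      rw [map_add] at this
      exact this

theorem IsProperCone.smul_mem_iff {C : Set V} {m : V →L[ℝ] ℝ} (hC : IsProperCone C m) {t : ℝ}
    (ht : 0 < t) {x : V} : t • x ∈ C ↔ x ∈ C := by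
  refine ⟨fun h => ?_, hC.smul_mem t ht x⟩
  have := hC.smul_mem t⁻¹ (inv_pos.2 ht) _ h
  rwa [smul_smul, inv_mul_cancel₀ ht.ne', one_smul] at this

theorem DividesCone.mem_iff {C : Set V} {Γ : Subgroup (V ≃ₗ[ℝ] V)} (hΓ : DividesCone C Γ)
    {γ : V ≃ₗ[ℝ] V} (hγ : γ ∈ Γ) {x : V} : γ x ∈ C ↔ x ∈ C := by
  refine ⟨fun h => ?_, hΓ.map_mem γ hγ x⟩
  have := hΓ.map_mem γ⁻¹ (Γ.inv_mem hγ) _ h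
  rwa [← LinearEquiv.mul_apply, inv_mul_cancel] at this

theorem IsCompact.exists_pos_forall_add_mem {W : Type*} [NormedAddCommGroup W] {K C : Set W} (hK : IsCompact K) (hC : IsOpen C)
    (hKC : K ⊆ C) : ∃ ρ > 0, ∀ z ∈ K, ∀ b : W, ‖b‖ < ρ → z + b ∈ C := by
  obtain ⟨ρ, hρ, h⟩ := hK.exists_thickening_subset_open hC hKC
  refine ⟨ρ, hρ, fun z hz b hb => h ?_⟩
  rw [mem_thickening_iff]
  exact ⟨z, hz, by simpa using hb⟩

theorem opNorm_le_of_forall_ball {W : Type*} [NormedAddCommGroup W] [NormedSpace ℝ W]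
    (f : V →L[ℝ] W) {ρ B : ℝ} (hρ : 0 < ρ) (hB : 0 ≤ B)
    (h : ∀ b, ‖b‖ < ρ → ‖f b‖ ≤ B) : ‖f‖ ≤ 2 * B / ρ := by
  refine f.opNorm_le_bound (by positivity) fun v => ?_
  rcases eq_or_ne v 0 with rfl | hv
  · simp
  have hv' : 0 < ‖v‖ := norm_pos_iff.2 hv
  have h1 := h ((ρ / (2 * ‖v‖)) • v) (by
    rw [norm_smul, Real.norm_of_nonneg (by positivity)]
    field_simp
    linarith)
  rw [map_smul, norm_smul, Real.norm_of_nonneg (by positivity)] at h1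
  field_simp at h1 ⊢
  linarith

/-- If the face of a divisible cone cut out by the kernel of a projection is nondegenerate in that
kernel, then the cone is decomposable. -/
theorem isDecomposable_of_projection [FiniteDimensional ℝ V] {C : Set V} {m : V →L[ℝ] ℝ}
    (hC : IsProperCone C m) {Γ : Subgroup (V ≃ₗ[ℝ] V)} (hΓ : DividesCone C Γ)
    (π : V →L[ℝ] V) (hπ : ∀ v, π (π v) = π v) (l : V →L[ℝ] ℝ) (hl : ∀ y ∈ C, ‖π y‖ ≤ l y)
    (hlπ : ∀ v, l (π v) = l v)
    {p : V} (hp0 : p ≠ 0) (hp : π p = 0) {ε : ℝ} (hε : 0 < ε)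
    (hrel : ∀ v, π v = 0 → ‖v‖ < ε → p + v ∈ closure C) (hπ0 : ∃ v, π v ≠ 0) :
    IsDecomposable C := by
  obtain ⟨x₀, hx₀⟩ := hC.nonempty
  obtain ⟨K, hKC, hK, hcov⟩ := hΓ.cocompact
  let k : ℝ → V →L[ℝ] V := fun t => ContinuousLinearMap.id ℝ V - π + t • π
  have hk : ∀ t v, k t v = (v - π v) + t • π v := fun t v => by simp [k]
  obtain ⟨ρ, hρ, hρ1, hnear⟩ : ∃ ρ : ℝ, 0 < ρ ∧ ρ ≤ 1 ∧ ∀ t : ℝ, 0 < t → t < ρ → ∀ b : V,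
      ‖b‖ < ρ → k t (p + π x₀ + b) ∈ C := by
    have h1 : ∀ᶠ q : V × ℝ in nhds 0, ‖(q.1 - π q.1) - q.2 • (x₀ - π x₀)‖ < ε := by
      refine (IsOpen.preimage (f := fun q : V × ℝ => ‖(q.1 - π q.1) - q.2 • (x₀ - π x₀)‖)
        (by fun_prop) isOpen_Iio).mem_nhds ?_
      simpa using hε
    have h2 : ∀ᶠ q : V × ℝ in nhds 0, x₀ + π q.1 ∈ C := by
      refine (hC.isOpen.preimage (f := fun q : V × ℝ => x₀ + π q.1) (by fun_prop)).mem_nhds ?_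
      simpa using hx₀
    obtain ⟨ρ, hρ, h⟩ := Metric.eventually_nhds_iff.1 (h1.and h2)
    refine ⟨min ρ 1, lt_min hρ one_pos, min_le_right _ _, fun t ht htρ b hb => ?_⟩
    obtain ⟨ha, hb⟩ := h (y := (b, t)) (by
      rw [dist_zero_right, Prod.norm_def]
      refine max_lt (hb.trans_le (min_le_left _ _)) ?_
      rw [Real.norm_of_nonneg ht.le]
      exact htρ.trans_le (min_le_left _ _))
    have h3 := hC.add_mem_of_closure (hrel _ (by simp [hπ]) ha) (hC.smul_mem t ht _ hb)
    rw [hk]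
    convert h3 using 1
    simp only [map_add, hπ, hp]
    module
  set y := p + π x₀ with hy
  let t : ℕ → ℝ := fun n => ρ / (n + 2)
  have ht0 : ∀ n, 0 < t n := fun n => by positivity
  have htρ : ∀ n, t n < ρ := fun n => by
    simp only [t]
    rw [div_lt_iff₀ (by positivity)]
    have : (0 : ℝ) ≤ n := n.cast_nonneg
    nlinarith
  have ht : Tendsto t atTop (nhds 0) :=
    tendsto_const_nhds.div_atTop (tendsto_atTop_add_const_right _ _ tendsto_natCast_atTop_atTop)
  have hyn : ∀ n, k (t n) y ∈ C := fun n => by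
    simpa using hnear (t n) (ht0 n) (htρ n) 0 (by simpa)
  choose γ hγ s hs hsK using fun n => hcov _ (hyn n)
  let g : ℕ → V →L[ℝ] V := fun n =>
    s n • (LinearMap.toContinuousLinearMap (γ n : V →ₗ[ℝ] V)).comp (k (t n))
  have hgk : ∀ n v, g n v = s n • γ n (k (t n) v) := fun n v => rfl
  have hg : ∀ n v, g n v ∈ C ↔ (v - π v) + t n • π v ∈ C := fun n v => by
    rw [hgk, hC.smul_mem_iff (hs n), hΓ.mem_iff (hγ n), hk]
  have hgy : ∀ n, g n y ∈ K := hsK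
  obtain ⟨M, hM⟩ := hK.exists_bound_of_continuousOn m.continuous.continuousOn
  have hbound : ∀ n, ‖g n‖ ≤ 2 * (3 * M) / ρ := by
    intro n
    have hmy := (le_abs_self _).trans (hM _ (hgy n))
    have hpos := hC.pos (hKC (hgy n))
    refine opNorm_le_of_forall_ball _ hρ (by linarith) fun b hb => ?_
    have h1 : g n (y + b) ∈ C := by
      rw [hg, ← hk]; exact hnear _ (ht0 n) (htρ n) b hb
    have h2 : g n (y - b) ∈ C := by
      rw [hg, ← hk, sub_eq_add_neg]; exact hnear _ (ht0 n) (htρ n) (-b) (by rwa [norm_neg])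
    have h3 := hC.pos h2
    have h4 := hC.norm_le _ h1
    have h5 := hC.norm_le _ (hKC (hgy n))
    have h6 : ‖g n b‖ ≤ ‖g n (y + b)‖ + ‖g n y‖ := by
      have : g n b = g n (y + b) - g n y := by rw [map_add]; abel
      rw [this]; exact norm_sub_le _ _
    rw [map_sub, map_sub] at h3
    rw [(g n).map_add y b, m.map_add] at h4
    rw [(g n).map_add y b] at h6
    linarith
  obtain ⟨ρ', hρ', hadd⟩ := hK.exists_pos_forall_add_mem hC.isOpen hKC
  let N : V →L[ℝ] ℝ := m.comp (ContinuousLinearMap.id ℝ V - π) + (2 + ‖m‖) • l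
  have hN : ∀ v, N v = m (v - π v) + (2 + ‖m‖) * l v := fun v => rfl
  have hq : ∀ n q, g n q ∈ C → ‖q‖ ≤ N q := by
    intro n q hq
    rw [hg] at hq
    have h1 := hl _ hq
    rw [← hlπ] at h1
    simp only [map_add, map_sub, map_smul, hπ, hlπ, sub_self, zero_add, smul_eq_mul, norm_smul,
      Real.norm_of_nonneg (ht0 n).le] at h1
    have h1 : ‖π q‖ ≤ l q := le_of_mul_le_mul_left h1 (ht0 n)
    have h2 := hC.norm_le _ hq
    rw [map_add, map_smul, smul_eq_mul] at h2
    have h3 : ‖q - π q‖ ≤ ‖q - π q + t n • π q‖ + t n * ‖π q‖ := by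
      have : q - π q = (q - π q + t n • π q) - t n • π q := by abel
      calc ‖q - π q‖ = ‖(q - π q + t n • π q) - t n • π q‖ := by rw [← this]
        _ ≤ _ := (norm_sub_le _ _).trans_eq (by rw [norm_smul, Real.norm_of_nonneg (ht0 n).le])
    have h4 : m (π q) ≤ ‖m‖ * ‖π q‖ := (le_abs_self _).trans (m.le_opNorm _)
    have h5 : ‖q‖ ≤ ‖q - π q‖ + ‖π q‖ := by
      simpa using norm_add_le (q - π q) (π q)
    have ht1 : t n ≤ 1 := (htρ n).le.trans hρ1
    have h6 : t n * m (π q) ≤ ‖m‖ * ‖π q‖ :=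
      (mul_le_mul_of_nonneg_left h4 (ht0 n).le).trans
        (mul_le_of_le_one_left (by positivity) ht1)
    have h7 : t n * ‖π q‖ ≤ ‖π q‖ := mul_le_of_le_one_left (norm_nonneg _) ht1
    have h8 : ‖m‖ * ‖π q‖ ≤ ‖m‖ * l q := mul_le_mul_of_nonneg_left h1 (norm_nonneg _)
    rw [hN]
    nlinarith
  have hlow : ∀ n v, ‖g n v‖ < ρ' → ‖v‖ ≤ N y := by
    intro n v hv
    have h1 := hq n (y + v) (by rw [map_add]; exact hadd _ (hgy n) _ hv)
    have h2 := hq n (y - v) (by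
      rw [map_sub, sub_eq_add_neg]; exact hadd _ (hgy n) _ (by rwa [norm_neg]))
    have h3 : ‖v + v‖ ≤ ‖y + v‖ + ‖y - v‖ := by
      have : v + v = (y + v) - (y - v) := by abel
      rw [this]; exact norm_sub_le _ _
    rw [← two_smul ℝ v, norm_smul, Real.norm_of_nonneg zero_le_two] at h3
    rw [map_add] at h1
    rw [map_sub] at h2
    linarith
  have := FiniteDimensional.proper ℝ (V →L[ℝ] V)
  obtain ⟨G, -, φ, hφ, hG⟩ := tendsto_subseq_of_bounded (x := g)
    (isBounded_closedBall (x := (0 : V →L[ℝ] V)) (r := 2 * (3 * M) / ρ))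
    (fun n => by simpa using hbound n)
  refine isDecomposable_of_tendsto hC π hπ hp0 hp hε hrel hπ0 (t ∘ φ) (fun n => ht0 _)
    (ht.comp hφ.tendsto_atTop) (g ∘ φ) G ?_ hG (fun n v => hg _ v)
  rw [← ContinuousLinearMap.coe_coe, ← LinearMap.ker_eq_bot, LinearMap.ker_eq_bot']
  intro v hv
  have hv : G v = 0 := hv
  by_contra hv0
  have hball : ∀ r : ℝ, ‖r • v‖ ≤ N y := by
    intro r
    have h1 : Tendsto (fun n => ‖(g ∘ φ) n (r • v)‖) atTop (nhds ‖G (r • v)‖) :=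
      (((ContinuousLinearMap.apply ℝ V (r • v)).continuous.tendsto G).comp hG).norm
    rw [map_smul, hv, smul_zero, norm_zero] at h1
    obtain ⟨n, hn⟩ := (h1.eventually_lt_const hρ').exists
    exact hlow _ _ hn
  have hv' := norm_pos_iff.2 hv0
  have := hball ((|N y| + 1) / ‖v‖)
  rw [norm_smul, norm_div, norm_norm, div_mul_cancel₀ _ hv'.ne',
    Real.norm_of_nonneg (by positivity)] at this
  linarith [le_abs_self (N y)]

/-- Let a face of a divisible cone be cut out by supporting functionals `τ i`. If the face is
nondegenerate in the common kernel of these functionals, then the cone is decomposable. -/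
theorem isDecomposable_of_face [FiniteDimensional ℝ V] {C : Set V} {m : V →L[ℝ] ℝ}
    (hC : IsProperCone C m) {Γ : Subgroup (V ≃ₗ[ℝ] V)} (hΓ : DividesCone C Γ)
    {ι : Type*} [Fintype ι] (τ : ι → V →L[ℝ] ℝ) (hτ : ∀ i, ∀ y ∈ C, 0 ≤ τ i y)
    {p : V} (hp0 : p ≠ 0) (hp : ∀ i, τ i p = 0) {ε : ℝ} (hε : 0 < ε)
    (hrel : ∀ v, (∀ i, τ i v = 0) → ‖v‖ < ε → p + v ∈ closure C) (h0 : ∃ v i, τ i v ≠ 0) :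
    IsDecomposable C := by
  let T : V →ₗ[ℝ] (ι → ℝ) := LinearMap.pi fun i => (τ i : V →ₗ[ℝ] ℝ)
  have hT : ∀ v i, T v i = τ i v := fun v i => rfl
  obtain ⟨s, hs⟩ := LinearMap.exists_rightInverse_of_surjective T.rangeRestrict
    (LinearMap.range_rangeRestrict T)
  have hs' : ∀ w, T.rangeRestrict (s w) = w := fun w => LinearMap.congr_fun hs w
  let S := LinearMap.toContinuousLinearMap s
  let π : V →L[ℝ] V := LinearMap.toContinuousLinearMap (s.comp T.rangeRestrict)
  have hπs : ∀ v, π v = s (T.rangeRestrict v) := fun v => rfl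
  have hTπ : ∀ v, T.rangeRestrict (π v) = T.rangeRestrict v := fun v => by rw [hπs, hs']
  have hτπ : ∀ v i, τ i (π v) = τ i v := fun v i => by
    rw [← hT, ← hT]; exact congrFun (congrArg Subtype.val (hTπ v)) i
  have hπ0 : ∀ v, π v = 0 ↔ ∀ i, τ i v = 0 := by
    intro v
    constructor
    · intro h i
      rw [← hτπ, h, map_zero]
    · intro h
      have : T.rangeRestrict v = 0 := Subtype.ext (funext h)
      rw [hπs, this, map_zero]
  refine isDecomposable_of_projection hC hΓ π (fun v => ?_) (‖S‖ • ∑ i, τ i) ?_ ?_ hp0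
    ((hπ0 p).2 hp) hε (fun v hv => hrel v ((hπ0 v).1 hv)) ?_
  · rw [hπs, hTπ, ← hπs]
  · intro y hy
    have h1 : ‖T.rangeRestrict y‖ ≤ ∑ i, τ i y := by
      change ‖T y‖ ≤ _
      refine (pi_norm_le_iff_of_nonneg (Finset.sum_nonneg fun i _ => hτ i y hy)).2 fun i => ?_
      rw [hT, Real.norm_of_nonneg (hτ i y hy)]
      exact Finset.single_le_sum (f := fun i => τ i y) (fun i _ => hτ i y hy) (Finset.mem_univ i)
    calc ‖π y‖ = ‖S (T.rangeRestrict y)‖ := rfl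
      _ ≤ ‖S‖ * ‖T.rangeRestrict y‖ := S.le_opNorm _
      _ ≤ ‖S‖ * ∑ i, τ i y := mul_le_mul_of_nonneg_left h1 (norm_nonneg S)
      _ = _ := by simp
  · intro v
    simp [hτπ]
  · obtain ⟨v, i, hi⟩ := h0
    exact ⟨v, fun h => hi ((hπ0 v).1 h i)⟩

theorem LinearIndependent.exists_coords [FiniteDimensional ℝ V] {ι : Type*} [Fintype ι]
    {z : ι → V} (hz : LinearIndependent ℝ z) :
    ∃ L : V →L[ℝ] (ι → ℝ), ∀ c : ι → ℝ, L (∑ j, c j • z j) = c := by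
  obtain ⟨L, hL⟩ := LinearMap.exists_leftInverse_of_injective (Fintype.linearCombination ℝ z)
    (LinearMap.ker_eq_bot.2 hz.fintypeLinearCombination_injective)
  refine ⟨LinearMap.toContinuousLinearMap L, fun c => ?_⟩
  have := LinearMap.congr_fun hL c
  rwa [LinearMap.comp_apply, Fintype.linearCombination_apply] at this

theorem exists_eq_sum_of_ker [FiniteDimensional ℝ V] {d : ℕ} (hdim : Module.finrank ℝ V = d + 1)
    {τ : V →L[ℝ] ℝ} (hτ : τ ≠ 0) {z : Fin d → V} (hz : LinearIndependent ℝ z)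
    (hτz : ∀ j, τ (z j) = 0) {v : V} (hv : τ v = 0) : ∃ c : Fin d → ℝ, v = ∑ j, c j • z j := by
  have h1 : Submodule.span ℝ (range z) ≤ LinearMap.ker (τ : V →ₗ[ℝ] ℝ) := by
    rw [Submodule.span_le]
    rintro _ ⟨j, rfl⟩
    exact hτz j
  have h2 : Module.finrank ℝ (LinearMap.ker (τ : V →ₗ[ℝ] ℝ)) + 1 = Module.finrank ℝ V :=
    Module.Dual.finrank_ker_add_one_of_ne_zero (f := (τ : V →ₗ[ℝ] ℝ)) fun h =>
      hτ (ContinuousLinearMap.coe_injective h)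
  have h3 := Submodule.eq_of_le_of_finrank_eq h1 (by
    rw [finrank_span_eq_card hz, Fintype.card_fin]
    omega)
  have h4 : v ∈ Submodule.span ℝ (range z) := h3 ▸ hv
  obtain ⟨c, hc⟩ := (Submodule.mem_span_range_iff_exists_fun ℝ).1 h4
  exact ⟨c, hc.symm⟩

/-- An indecomposable proper cone of dimension `d + 1 ≥ 4` divided by a torsion-free group. -/
structure IsDividedCone (d : ℕ) (C : Set V) (m : V →L[ℝ] ℝ) (Γ : Subgroup (V ≃ₗ[ℝ] V)) :
    Prop where
  proper : IsProperCone C m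
  divides : DividesCone C Γ
  indecomposable : ¬ IsDecomposable C
  three_le : 3 ≤ d
  finrank_eq : Module.finrank ℝ V = d + 1

/-- The kernel of `l` meets `C` in the open simplicial cone generated by `u`. -/
def IsFlatFormWith {d : ℕ} (C : Set V) (l : V →L[ℝ] ℝ) (u : Fin d → V) : Prop :=
  l ≠ 0 ∧ LinearIndependent ℝ u ∧
    ∀ z, (z ∈ C ∧ l z = 0) ↔ ∃ c : Fin d → ℝ, (∀ j, 0 < c j) ∧ z = ∑ j, c j • u j

/-- The kernel of `l` meets `C` in an open simplicial cone. -/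
def IsFlatForm (d : ℕ) (C : Set V) (l : V →L[ℝ] ℝ) : Prop :=
  ∃ u : Fin d → V, IsFlatFormWith C l u

section

variable {C : Set V} {m : V →L[ℝ] ℝ} {Γ : Subgroup (V ≃ₗ[ℝ] V)} {d : ℕ}

theorem IsProperCone.mem_closure_of_forall_add_smul {x y : V}
    (h : ∀ ε : ℝ, 0 < ε → x + ε • y ∈ closure C) : x ∈ closure C := by
  have hl : Tendsto (fun ε : ℝ => x + ε • y) (nhdsWithin 0 (Ioi 0)) (nhds (x + (0 : ℝ) • y)) :=
    ((by fun_prop : Continuous fun ε : ℝ => x + ε • y).tendsto 0).mono_left nhdsWithin_le_nhds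
  rw [zero_smul, add_zero] at hl
  have := mem_closure_of_tendsto hl (eventually_nhdsWithin_of_forall h)
  rwa [closure_closure] at this

namespace IsFlatFormWith

variable {l : V →L[ℝ] ℝ} {u : Fin d → V}

theorem sum_mem (h : IsFlatFormWith C l u) {c : Fin d → ℝ} (hc : ∀ j, 0 < c j) :
    ∑ j, c j • u j ∈ C :=
  ((h.2.2 _).2 ⟨c, hc, rfl⟩).1

theorem apply_sum (h : IsFlatFormWith C l u) {c : Fin d → ℝ} (hc : ∀ j, 0 < c j) :
    l (∑ j, c j • u j) = 0 :=
  ((h.2.2 _).2 ⟨c, hc, rfl⟩).2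

theorem apply_eq_zero (h : IsFlatFormWith C l u) (i : Fin d) : l (u i) = 0 := by
  have h1 := h.apply_sum (c := fun _ => 1) fun _ => one_pos
  have h2 := h.apply_sum (c := fun j => if j = i then 2 else 1) fun j => by split_ifs <;> norm_num
  have h3 : ∑ j, (if j = i then (2 : ℝ) else 1) • u j = ∑ j, (1 : ℝ) • u j + u i := by
    have : ∀ j, (if j = i then (2 : ℝ) else 1) • u j =
        (1 : ℝ) • u j + (if j = i then u j else 0) := by
      intro j
      split_ifs
      · module
      · simp
    simp_rw [this, Finset.sum_add_distrib]
    simp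
  rw [h3, map_add, h1, zero_add] at h2
  exact h2

theorem apply_sum' (h : IsFlatFormWith C l u) (c : Fin d → ℝ) : l (∑ j, c j • u j) = 0 := by
  simp [h.apply_eq_zero]

theorem coeff_injective (h : IsFlatFormWith C l u) {c c' : Fin d → ℝ}
    (hc : ∑ j, c j • u j = ∑ j, c' j • u j) : c = c' :=
  h.2.1.fintypeLinearCombination_injective hc

theorem sum_mem_iff (h : IsFlatFormWith C l u) {c : Fin d → ℝ} :
    ∑ j, c j • u j ∈ C ↔ ∀ j, 0 < c j := by
  refine ⟨fun hm => ?_, h.sum_mem⟩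
  obtain ⟨c', hc', he⟩ := (h.2.2 _).1 ⟨hm, h.apply_sum' c⟩
  rwa [h.coeff_injective he]

/-- The barycenter of the simplicial cone. -/
theorem sum_one_mem (h : IsFlatFormWith C l u) : ∑ j, u j ∈ C := by
  simpa using h.sum_mem (c := fun _ => 1) fun _ => one_pos

theorem apply_sum_one (h : IsFlatFormWith C l u) : l (∑ j, u j) = 0 := by
  simpa using h.apply_sum (c := fun _ => 1) fun _ => one_pos

theorem exists_eq_sum (hC : IsProperCone C m) (h : IsFlatFormWith C l u) {w : V} (hw : l w = 0) :
    ∃ c : Fin d → ℝ, w = ∑ j, c j • u j := by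
  obtain ⟨ε, hε, hs⟩ := hC.exists_pos_forall_add_smul_mem h.sum_one_mem w
  have h1 := hs (ε / 2) (by rw [abs_of_pos (half_pos hε)]; exact half_lt_self hε)
  obtain ⟨c, -, hc⟩ := (h.2.2 _).1 ⟨h1, by simp [h.apply_sum_one, hw]⟩
  refine ⟨fun j => (2 / ε) * (c j - 1), ?_⟩
  simp_rw [mul_smul, ← Finset.smul_sum, sub_smul, Finset.sum_sub_distrib, ← hc, one_smul]
  rw [add_sub_cancel_left, smul_smul, div_mul_div_cancel₀' two_ne_zero, div_self hε.ne', one_smul]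

theorem mem_closure (h : IsFlatFormWith C l u) {c : Fin d → ℝ} (hc : ∀ j, 0 ≤ c j) :
    ∑ j, c j • u j ∈ closure C := by
  refine IsProperCone.mem_closure_of_forall_add_smul (y := ∑ j, u j) fun ε hε => subset_closure ?_
  rw [Finset.smul_sum, ← Finset.sum_add_distrib]
  simp_rw [← add_smul]
  exact h.sum_mem fun j => add_pos_of_nonneg_of_pos (hc j) hε

theorem basis_mem_closure (h : IsFlatFormWith C l u) (i : Fin d) : u i ∈ closure C := by
  have := h.mem_closure (c := fun j => if j = i then 1 else 0) fun j => by split_ifs <;> norm_num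
  simpa using this

theorem nonneg_of_mem_closure (hC : IsProperCone C m) (h : IsFlatFormWith C l u) {c : Fin d → ℝ}
    (hc : ∑ j, c j • u j ∈ closure C) (i : Fin d) : 0 ≤ c i := by
  refine le_of_forall_pos_le_add fun ε hε => ?_
  have h1 := hC.add_mem_of_closure hc (hC.smul_mem ε hε _ h.sum_one_mem)
  rw [Finset.smul_sum, ← Finset.sum_add_distrib] at h1
  simp_rw [← add_smul] at h1
  exact (h.sum_mem_iff.1 h1 i).le

theorem exists_nonneg (hC : IsProperCone C m) (h : IsFlatFormWith C l u) {w : V}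
    (hw : w ∈ closure C) (hw0 : l w = 0) : ∃ c : Fin d → ℝ, (∀ j, 0 ≤ c j) ∧
      w = ∑ j, c j • u j := by
  obtain ⟨c, rfl⟩ := h.exists_eq_sum hC hw0
  exact ⟨c, h.nonneg_of_mem_closure hC hw, rfl⟩

theorem basis_ne_zero (h : IsFlatFormWith C l u) (i : Fin d) : u i ≠ 0 := h.2.1.ne_zero i

/-- A partial sum of the generators lies in the boundary of the cone. -/
theorem sum_erase_notMem (h : IsFlatFormWith C l u) (i : Fin d) :
    ∑ j ∈ Finset.univ.erase i, u j ∉ C := by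
  intro hm
  have h1 : ∑ j, (if j = i then (0 : ℝ) else 1) • u j ∈ C := by
    simpa [ite_smul, Finset.sum_ite, Finset.filter_ne'] using hm
  simpa using h.sum_mem_iff.1 h1 i

theorem sum_erase_mem_closure (hC : IsProperCone C m) (h : IsFlatFormWith C l u) (i : Fin d) :
    ∑ j ∈ Finset.univ.erase i, u j ∈ closure C :=
  hC.closure_sum _ _ fun j _ => h.basis_mem_closure j

/-- Functionals supporting the cone at the facets of a flat. -/
theorem exists_facet_support (hC : IsProperCone C m) (h : IsFlatFormWith C l u) (i : Fin d) :
    ∃ τ : V →L[ℝ] ℝ, (∀ y ∈ C, 0 < τ y) ∧ (∀ j, j ≠ i → τ (u j) = 0) ∧ 0 < τ (u i) := by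
  obtain ⟨τ, hτ, hpos⟩ := hC.exists_support (h.sum_erase_mem_closure hC i) (h.sum_erase_notMem i)
  have hnn : ∀ j, 0 ≤ τ (u j) := fun j =>
    IsProperCone.nonneg_of_closure (fun y hy => (hpos y hy).le) (h.basis_mem_closure j)
  rw [map_sum, Finset.sum_eq_zero_iff_of_nonneg fun j _ => hnn j] at hτ
  have hz : ∀ j, j ≠ i → τ (u j) = 0 := fun j hj => hτ j (by simp [hj])
  refine ⟨τ, hpos, hz, ?_⟩
  have h1 := hpos _ h.sum_one_mem
  rwa [map_sum, Finset.sum_eq_single i (fun j _ hj => hz j hj) (by simp)] at h1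

end IsFlatFormWith

/-- No supporting hyperplane of an indecomposable divisible cone meets it in a face of full
dimension. -/
theorem IsDividedCone.not_linearIndependent [FiniteDimensional ℝ V]
    (h : IsDividedCone d C m Γ) {z : Fin d → V} (hz : LinearIndependent ℝ z)
    (hzC : ∀ j, z j ∈ closure C) {τ : V →L[ℝ] ℝ} (hτ : ∀ y ∈ C, 0 < τ y)
    (hτz : ∀ j, τ (z j) = 0) : False := by
  obtain ⟨c, hc⟩ := h.proper.nonempty
  have hτ0 : τ ≠ 0 := by
    rintro rfl
    simpa using hτ c hc
  obtain ⟨L, hL⟩ := hz.exists_coords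
  have hL1 : ∀ᶠ v in nhds (0 : V), ‖L v‖ < 1 := by
    refine (isOpen_Iio.preimage (by fun_prop : Continuous fun v => ‖L v‖)).mem_nhds ?_
    simp
  obtain ⟨ε, hε, hL1⟩ := Metric.eventually_nhds_iff.1 hL1
  refine h.indecomposable (isDecomposable_of_face h.proper h.divides (fun _ : Unit => τ)
    (fun _ y hy => (hτ y hy).le) (p := ∑ j, z j) ?_ (by simp [hτz]) hε ?_ ⟨c, (), (hτ c hc).ne'⟩)
  · intro h0
    have h1 := Fintype.linearIndependent_iff.1 hz (fun _ => 1) (by simpa using h0)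
      ⟨0, by have := h.three_le; omega⟩
    exact one_ne_zero h1
  · intro v hv hvε
    obtain ⟨b, rfl⟩ := exists_eq_sum_of_ker h.finrank_eq hτ0 hz hτz (hv ())
    have h1 := hL1 (y := ∑ j, b j • z j) (by simpa using hvε)
    rw [hL] at h1
    rw [← Finset.sum_add_distrib]
    refine h.proper.closure_sum _ _ fun j _ => ?_
    have h2 : |b j| < 1 := (norm_le_pi_norm b j).trans_lt h1
    have h3 : z j + b j • z j = (1 + b j) • z j := by module
    rw [h3]
    exact h.proper.closure_smul (by linarith [(abs_lt.1 h2).1]) (hzC j)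

theorem LinearIndependent.update_of_apply_ne_zero {ι : Type*} [Fintype ι] [DecidableEq ι]
    {z : ι → V} (hz : LinearIndependent ℝ z) (i : ι) {l : V →L[ℝ] ℝ}
    (hl : ∀ j, j ≠ i → l (z j) = 0) {p : V} (hp : l p ≠ 0) :
    LinearIndependent ℝ (Function.update z i p) := by
  rw [Fintype.linearIndependent_iff] at hz ⊢
  intro g hg
  have h1 : g i = 0 := by
    have := congrArg l hg
    rw [map_sum, map_zero, Finset.sum_eq_single i (fun j _ hj => by simp [hj, hl j hj])
      (by simp)] at this
    simpa [hp] using this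
  refine hz g (hg ▸ Finset.sum_congr rfl fun j _ => ?_)
  rcases eq_or_ne j i with rfl | hj
  · simp [h1]
  · simp [hj]

/-- The closure of a flat is extremal in the closed cone at its boundary points. -/
theorem IsDividedCone.apply_eq_zero_of_add [FiniteDimensional ℝ V]
    (h : IsDividedCone d C m Γ) {l : V →L[ℝ] ℝ} (hl : IsFlatForm d C l) {p q : V}
    (hp : p ∈ closure C) (hq : q ∈ closure C) (hpq : p + q ∉ C) (hl0 : l (p + q) = 0) :
    l p = 0 := by
  obtain ⟨u, hu⟩ := hl
  obtain ⟨c, hc, hce⟩ := hu.exists_nonneg h.proper (h.proper.closure_add hp hq) hl0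
  obtain ⟨i, hi⟩ : ∃ i, c i = 0 := by
    by_contra! hne
    exact hpq (hce ▸ hu.sum_mem fun j => (hc j).lt_of_ne' (hne j))
  obtain ⟨τ, hτ, hτu, -⟩ := hu.exists_facet_support h.proper i
  have h1 : τ (p + q) = 0 := by
    rw [hce, map_sum]
    refine Finset.sum_eq_zero fun j _ => ?_
    rcases eq_or_ne j i with rfl | hj
    · simp [hi]
    · simp [hτu j hj]
  have hτp := IsProperCone.nonneg_of_closure (fun y hy => (hτ y hy).le) hp
  have hτq := IsProperCone.nonneg_of_closure (fun y hy => (hτ y hy).le) hq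
  rw [map_add] at h1
  have hτp0 : τ p = 0 := by linarith
  by_contra hlp
  refine h.not_linearIndependent (hu.2.1.update_of_apply_ne_zero i (l := l)
    (fun j _ => hu.apply_eq_zero j) hlp) (fun j => ?_) hτ fun j => ?_
  · rcases eq_or_ne j i with rfl | hj
    · simpa
    · simpa [hj] using hu.basis_mem_closure j
  · rcases eq_or_ne j i with rfl | hj
    · simpa
    · simpa [hj] using hτu j hj

end

section

variable {C : Set V} {m : V →L[ℝ] ℝ} {Γ : Subgroup (V ≃ₗ[ℝ] V)} {d : ℕ}

theorem IsFlatFormWith.basis_notMem (hd : 3 ≤ d) {l : V →L[ℝ] ℝ} {u : Fin d → V}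
    (h : IsFlatFormWith C l u) (i : Fin d) : u i ∉ C := by
  obtain ⟨j, hj⟩ := Fintype.exists_ne_of_one_lt_card (by simp; omega) i
  intro hm
  have h1 : ∑ k, (if k = i then (1 : ℝ) else 0) • u k ∈ C := by simpa using hm
  have := h.sum_mem_iff.1 h1 j
  simp [hj] at this

namespace IsDividedCone

variable [FiniteDimensional ℝ V] {l l' : V →L[ℝ] ℝ} {u u' : Fin d → V}

theorem apply_basis_eq_zero_of_sum (h : IsDividedCone d C m Γ) (hl' : IsFlatForm d C l')
    (hu : IsFlatFormWith C l u) {c : Fin d → ℝ} (hc : ∀ j, 0 ≤ c j)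
    (hcC : ∑ j, c j • u j ∉ C) (h0 : l' (∑ j, c j • u j) = 0) {i : Fin d} (hi : 0 < c i) :
    l' (u i) = 0 := by
  rw [← Finset.add_sum_erase _ _ (Finset.mem_univ i)] at hcC h0
  have h1 := h.apply_eq_zero_of_add hl' (h.proper.closure_smul (hc i) (hu.basis_mem_closure i))
    (h.proper.closure_sum _ _ fun j _ => h.proper.closure_smul (hc j) (hu.basis_mem_closure j))
    hcC h0
  rw [map_smul, smul_eq_mul] at h1
  exact (mul_eq_zero.1 h1).resolve_left hi.ne'

theorem exists_apply_basis_eq_zero (h : IsDividedCone d C m Γ) (hl' : IsFlatForm d C l')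
    (hu : IsFlatFormWith C l u) {y : V} (hy : y ∈ closure C) (hy0 : y ≠ 0) (hly : l y = 0)
    (hly' : l' y = 0) : ∃ i, l' (u i) = 0 := by
  obtain ⟨c, hc, rfl⟩ := hu.exists_nonneg h.proper hy hly
  by_cases hyC : ∑ j, c j • u j ∈ C
  · by_contra! hne
    have hcpos := hu.sum_mem_iff.1 hyC
    rw [map_sum] at hly'
    simp only [map_smul, smul_eq_mul] at hly'
    have hd := h.three_le
    obtain ⟨i, -, hi⟩ := Finset.exists_pos_of_sum_zero_of_exists_nonzero _ hly'
      ⟨⟨0, by omega⟩, Finset.mem_univ _, mul_ne_zero (hcpos _).ne' (hne _)⟩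
    obtain ⟨k, -, hk⟩ := Finset.exists_pos_of_sum_zero_of_exists_nonzero
      (f := fun j => -(c j * l' (u j))) (s := Finset.univ) (by simpa using hly')
      ⟨⟨0, by omega⟩, Finset.mem_univ _, neg_ne_zero.2 (mul_ne_zero (hcpos _).ne' (hne _))⟩
    have hi' : 0 < l' (u i) := pos_of_mul_pos_right hi (hcpos i).le
    have hk' : 0 < - l' (u k) := by
      rw [← mul_neg] at hk
      exact pos_of_mul_pos_right hk (hcpos k).le
    have hik : i ≠ k := by
      rintro rfl
      linarith
    obtain ⟨r, hr⟩ := Finset.exists_mem_notMem_of_card_lt_card (s := {i, k})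
      (t := (Finset.univ : Finset (Fin d))) (by
        have := Finset.card_le_two (a := i) (b := k)
        simp
        omega)
    have hri : r ≠ i := fun e => hr.2 (by simp [e])
    have hrk : r ≠ k := fun e => hr.2 (by simp [e])
    let c' : Fin d → ℝ := fun j => if j = i then -l' (u k) else if j = k then l' (u i) else 0
    have hsum : ∑ j, c' j • u j = (-l' (u k)) • u i + l' (u i) • u k := by
      rw [Finset.sum_eq_add i k hik (fun j _ hj => by simp [c', hj.1, hj.2]) (by simp) (by simp)]
      simp [c', hik.symm]
    refine hi'.ne' (h.apply_basis_eq_zero_of_sum hl' hu (c := c') (fun j => ?_) (fun hm => ?_) ?_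
      (i := i) (by simpa [c'] using hk'))
    · simp only [c']
      split_ifs
      exacts [hk'.le, hi'.le, le_rfl]
    · have := hu.sum_mem_iff.1 hm r
      simp [c', hri, hrk] at this
    · rw [hsum]
      simp
      ring
  · obtain ⟨i, hi⟩ : ∃ i, c i ≠ 0 := by
      by_contra! h0
      exact hy0 (by simp [h0])
    exact ⟨i, h.apply_basis_eq_zero_of_sum hl' hu hc hyC hly' ((hc i).lt_of_ne' hi)⟩

/-- Two flats with a common point have a common vertex. -/
theorem exists_common_basis (h : IsDividedCone d C m Γ) (hu : IsFlatFormWith C l u)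
    (hu' : IsFlatFormWith C l' u') {y : V} (hy : y ∈ closure C) (hy0 : y ≠ 0) (hly : l y = 0)
    (hly' : l' y = 0) : ∃ i k, ∃ b : ℝ, 0 < b ∧ u' k = b • u i := by
  obtain ⟨i, hi⟩ := h.exists_apply_basis_eq_zero ⟨u', hu'⟩ hu hy hy0 hly hly'
  obtain ⟨c, hc, hce⟩ := hu'.exists_nonneg h.proper (hu.basis_mem_closure i) hi
  obtain ⟨k, hk⟩ : ∃ k, c k ≠ 0 := by
    by_contra! h0
    exact hu.basis_ne_zero i (by simp [hce, h0])
  have hk : 0 < c k := (hc k).lt_of_ne' hk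
  have hlk : l (u' k) = 0 := h.apply_basis_eq_zero_of_sum ⟨u, hu⟩ hu' hc
    (hce ▸ hu.basis_notMem h.three_le i) (hce ▸ hu.apply_eq_zero i) hk
  obtain ⟨b, hb, hbe⟩ := hu.exists_nonneg h.proper (hu'.basis_mem_closure k) hlk
  rw [← Finset.add_sum_erase _ _ (Finset.mem_univ k)] at hce
  have hr : ∑ j ∈ Finset.univ.erase k, c j • u' j ∈ closure C :=
    h.proper.closure_sum _ _ fun j _ => h.proper.closure_smul (hc j) (hu'.basis_mem_closure j)
  have hlr : l (∑ j ∈ Finset.univ.erase k, c j • u' j) = 0 := by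
    have := congrArg l hce
    rw [hu.apply_eq_zero, map_add, map_smul, hlk, smul_zero, zero_add] at this
    exact this.symm
  obtain ⟨b', hb', hbe'⟩ := hu.exists_nonneg h.proper hr hlr
  rw [hbe', hbe, Finset.smul_sum, ← Finset.sum_add_distrib] at hce
  simp_rw [smul_smul, ← add_smul] at hce
  have h1 : (fun j => if j = i then (1 : ℝ) else 0) = fun j => c k * b j + b' j :=
    hu.coeff_injective (by simpa using hce)
  have h2 : ∀ j, j ≠ i → b j = 0 := by
    intro j hj
    have := congrFun h1 j
    simp only [hj, if_false] at this
    nlinarith [hb j, hb' j, mul_nonneg hk.le (hb j)]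
  have h3 : u' k = b i • u i := by
    rw [hbe, Finset.sum_eq_single i (fun j _ hj => by simp [h2 j hj]) (by simp)]
  refine ⟨i, k, b i, (hb i).lt_of_ne' fun h0 => hu'.basis_ne_zero k ?_, h3⟩
  rw [h3, h0, zero_smul]

theorem apply_eq_zero_of_common (h : IsDividedCone d C m Γ) (hl : IsFlatForm d C l)
    (hl' : IsFlatForm d C l') {y : V} (hy : y ∈ closure C) (hy0 : y ≠ 0) (hly : l y = 0)
    (hly' : l' y = 0) {z : V} (hz : l' z = 0) : l z = 0 := by
  obtain ⟨u, hu⟩ := hl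
  obtain ⟨u', hu'⟩ := hl'
  have hd := h.three_le
  obtain ⟨i, k, b, hb, hik⟩ := h.exists_common_basis hu hu' hy hy0 hly hly'
  choose τ hτ hτ0 hτp using fun j => hu.exists_facet_support h.proper j
  choose τ' hτ' hτ0' hτp' using fun j => hu'.exists_facet_support h.proper j
  have hτi : ∀ j, j ≠ k → τ' j (u i) = 0 := by
    intro j hj
    have h1 := hτ0' j k hj.symm
    rw [hik, map_smul, smul_eq_mul] at h1
    exact (mul_eq_zero.1 h1).resolve_left hb.ne'
  obtain ⟨w, hw, hw', hwv⟩ : ∃ w, (∀ j, j ≠ i → τ j w = 0) ∧ (∀ j, j ≠ k → τ' j w = 0) ∧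
      ∀ c : ℝ, w ≠ c • u i := by
    by_contra! hcon
    obtain ⟨x, hx⟩ := h.proper.nonempty
    obtain ⟨j, hj⟩ := Fintype.exists_ne_of_one_lt_card (by simp; omega) i
    refine h.indecomposable (isDecomposable_of_face h.proper h.divides
      (Sum.elim (fun j : {j // j ≠ i} => τ j) fun j : {j // j ≠ k} => τ' j) ?_
      (p := u i) (hu.basis_ne_zero i) ?_ (norm_pos_iff.2 (hu.basis_ne_zero i)) ?_
      ⟨x, Sum.inl ⟨j, hj⟩, (hτ j x hx).ne'⟩)
    · rintro (j | j) y hy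
      exacts [(hτ j y hy).le, (hτ' j y hy).le]
    · rintro (j | j)
      exacts [hτ0 j i j.2.symm, hτi j j.2]
    · intro v hv hvε
      obtain ⟨c, rfl⟩ := hcon v (fun j hj => hv (Sum.inl ⟨j, hj⟩)) fun j hj => hv (Sum.inr ⟨j, hj⟩)
      rw [norm_smul] at hvε
      have hc : |c| < 1 := by
        by_contra! hc
        exact hvε.not_ge (le_mul_of_one_le_left (norm_nonneg _) hc)
      have e : u i + c • u i = (1 + c) • u i := by module
      rw [e]
      exact h.proper.closure_smul (by linarith [(abs_lt.1 hc).1]) (hu.basis_mem_closure i)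
  have hlw : l w ≠ 0 := by
    intro h0
    obtain ⟨c, rfl⟩ := hu.exists_eq_sum h.proper h0
    refine hwv (c i) (Finset.sum_eq_single i (fun j _ hj => ?_) (by simp))
    have h1 := hw j hj
    rw [map_sum, Finset.sum_eq_single j (fun r _ hr => by simp [hτ0 j r hr]) (by simp), map_smul,
      smul_eq_mul] at h1
    rw [(mul_eq_zero.1 h1).resolve_right (hτp j).ne', zero_smul]
  have hσ : ∀ s, ∃ j, s ≠ k → j ≠ i ∧ 0 < τ' s (u j) ∧ ∀ r, r ≠ k → r ≠ s → τ' r (u j) = 0 := by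
    intro s
    by_cases hs : s = k
    · exact ⟨i, fun h => (h hs).elim⟩
    obtain ⟨c, hc⟩ := hu.exists_eq_sum h.proper (w := u' s - (l (u' s) / l w) • w) (by
      simp [hlw])
    have hc : u' s = ∑ j, c j • u j + (l (u' s) / l w) • w := by rw [← hc]; abel
    have hcnn : ∀ j, j ≠ i → 0 ≤ c j := by
      intro j hj
      have h1 := IsProperCone.nonneg_of_closure (fun y hy => (hτ j y hy).le)
        (hu'.basis_mem_closure s)
      rw [hc, map_add, map_smul, hw j hj, smul_zero, add_zero, map_sum,
        Finset.sum_eq_single j (fun r _ hr => by simp [hτ0 j r hr]) (by simp), map_smul,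
        smul_eq_mul] at h1
      exact nonneg_of_mul_nonneg_left h1 (hτp j)
    have hτs : ∀ r, r ≠ k → τ' r (u' s) = ∑ j, c j * τ' r (u j) := by
      intro r hr
      conv_lhs => rw [hc]
      rw [map_add, map_smul, hw' r hr, smul_zero, add_zero, map_sum]
      simp
    have hnn : ∀ r, r ≠ k → ∀ j, 0 ≤ c j * τ' r (u j) := by
      intro r hr j
      rcases eq_or_ne j i with rfl | hj
      · simp [hτi r hr]
      · exact mul_nonneg (hcnn j hj)
          (IsProperCone.nonneg_of_closure (fun y hy => (hτ' r y hy).le) (hu.basis_mem_closure j))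
    obtain ⟨j, -, hj⟩ := Finset.exists_lt_of_sum_lt (s := Finset.univ) (f := fun _ => (0 : ℝ))
      (g := fun j => c j * τ' s (u j)) (by
        rw [← hτs s hs]
        simpa using hτp' s)
    refine ⟨j, fun _ => ⟨?_, ?_, fun r hr hrs => ?_⟩⟩
    · rintro rfl
      simp [hτi s hs] at hj
    · have hji : j ≠ i := by
        rintro rfl
        simp [hτi s hs] at hj
      exact pos_of_mul_pos_right hj (hcnn j hji)
    · have h0 := hτ0' r s (Ne.symm hrs)
      rw [hτs r hr, Finset.sum_eq_zero_iff_of_nonneg fun j _ => hnn r hr j] at h0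
      have h1 := h0 j (Finset.mem_univ j)
      refine (mul_eq_zero.1 h1).resolve_left fun h2 => ?_
      simp [h2] at hj
  choose σ hσ using hσ
  let ρ : Fin d → Fin d := fun s => if s = k then i else σ s
  have hρ : Function.Injective ρ := by
    intro s r hsr
    by_contra hne
    simp only [ρ] at hsr
    split_ifs at hsr with h1 h2 h2
    · exact hne (h1.trans h2.symm)
    · exact (hσ r h2).1 hsr.symm
    · exact (hσ s h1).1 hsr
    · have h3 := (hσ s h1).2.1
      rw [hsr, (hσ r h2).2.2 s h1 hne] at h3
      exact lt_irrefl _ h3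
  have hall : ∀ s, l (u' s) = 0 := by
    intro s
    by_cases hs : s = k
    · rw [hs, hik, map_smul, hu.apply_eq_zero, smul_zero]
    obtain ⟨r, -, hr⟩ := Finset.exists_mem_notMem_of_card_lt_card (s := {s, k})
      (t := (Finset.univ : Finset (Fin d))) (by
        have := Finset.card_le_two (a := s) (b := k)
        simp
        omega)
    have hrs : r ≠ s := fun e => hr (by simp [e])
    have hrk : r ≠ k := fun e => hr (by simp [e])
    by_contra hne
    refine h.not_linearIndependent ((hu.2.1.comp ρ hρ).update_of_apply_ne_zero r (l := l)
      (fun j _ => hu.apply_eq_zero _) hne) (fun j => ?_) (hτ' r) fun j => ?_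
    · rcases eq_or_ne j r with rfl | hj
      · simpa using hu'.basis_mem_closure s
      · simpa [hj] using hu.basis_mem_closure _
    · rcases eq_or_ne j r with rfl | hj
      · simpa using hτ0' j s (Ne.symm hrs)
      · simp only [ne_eq, hj, not_false_eq_true, Function.update_of_ne, Function.comp_apply, ρ]
        split_ifs with hjk
        · exact hτi r hrk
        · exact (hσ j hjk).2.2 r hrk (Ne.symm hj)
  obtain ⟨c, rfl⟩ := hu'.exists_eq_sum h.proper hz
  simp [hall]

/-- Two flats whose closures meet coincide. -/
theorem ker_eq_of_common (h : IsDividedCone d C m Γ) (hl : IsFlatForm d C l)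
    (hl' : IsFlatForm d C l') {y : V} (hy : y ∈ closure C) (hy0 : y ≠ 0) (hly : l y = 0)
    (hly' : l' y = 0) (z : V) : l z = 0 ↔ l' z = 0 :=
  ⟨fun hz => h.apply_eq_zero_of_common hl' hl hy hy0 hly' hly hz,
    fun hz => h.apply_eq_zero_of_common hl hl' hy hy0 hly hly' hz⟩

end IsDividedCone

end

section

variable {C : Set V} {m : V →L[ℝ] ℝ} {Γ : Subgroup (V ≃ₗ[ℝ] V)} {d : ℕ} {l l' : V →L[ℝ] ℝ}

theorem IsFlatForm.smul (h : IsFlatForm d C l) {c : ℝ} (hc : c ≠ 0) : IsFlatForm d C (c • l) := by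
  obtain ⟨u, h0, hu, h⟩ := h
  refine ⟨u, smul_ne_zero hc h0, hu, fun z => ?_⟩
  rw [← h]
  simp [hc]

theorem IsFlatForm.exists_unit (h : IsFlatForm d C l) :
    ∃ l₁, IsFlatForm d C l₁ ∧ ‖l₁‖ = 1 ∧ ∀ z, l₁ z = 0 ↔ l z = 0 := by
  have h0 : ‖l‖ ≠ 0 := norm_ne_zero_iff.2 h.choose_spec.1
  refine ⟨‖l‖⁻¹ • l, h.smul (inv_ne_zero h0), ?_, fun z => ?_⟩
  · rw [norm_smul, norm_inv, norm_norm, inv_mul_cancel₀ h0]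
  · simp [h.choose_spec.1]

/-- The functional `z ↦ l (γ z)`. -/
def pullForm [FiniteDimensional ℝ V] (γ : V ≃ₗ[ℝ] V) (l : V →L[ℝ] ℝ) : V →L[ℝ] ℝ :=
  l.comp (LinearMap.toContinuousLinearMap (γ : V →ₗ[ℝ] V))

theorem pullForm_apply [FiniteDimensional ℝ V] (γ : V ≃ₗ[ℝ] V) (l : V →L[ℝ] ℝ) (z : V) :
    pullForm γ l z = l (γ z) := rfl

theorem IsFlatForm.pullForm [FiniteDimensional ℝ V] (hΓ : DividesCone C Γ) (h : IsFlatForm d C l)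
    {γ : V ≃ₗ[ℝ] V} (hγ : γ ∈ Γ) : IsFlatForm d C (pullForm γ l) := by
  obtain ⟨u, h0, hu, h⟩ := h
  refine ⟨fun j => γ.symm (u j), fun h1 => h0 ?_, ?_, fun z => ?_⟩
  · ext z
    have := DFunLike.congr_fun h1 (γ.symm z)
    simpa [_root_.pullForm] using this
  · exact hu.map' (γ.symm : V →ₗ[ℝ] V) γ.symm.ker
  · have h2 := h (γ z)
    rw [hΓ.mem_iff hγ] at h2
    refine h2.trans (exists_congr fun c => and_congr_right fun _ => ?_)
    rw [← γ.symm.injective.eq_iff, γ.symm_apply_apply, map_sum]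
    simp

theorem IsFlatForm.exists_basis (hC : IsProperCone C m) (h : IsFlatForm d C l) :
    ∃ u : Fin d → V, IsFlatFormWith C l u ∧ ∀ j, m (u j) = 1 := by
  obtain ⟨u, hu⟩ := h
  have hpos : ∀ j, 0 < m (u j) := fun j => hC.pos_closure (hu.basis_mem_closure j)
    (hu.basis_ne_zero j)
  refine ⟨fun j => (m (u j))⁻¹ • u j, ⟨hu.1, ?_, fun z => ?_⟩, fun j => ?_⟩
  · exact hu.2.1.units_smul fun j => Units.mk0 _ (inv_ne_zero (hpos j).ne')
  · rw [hu.2.2]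
    constructor
    · rintro ⟨c, hc, rfl⟩
      refine ⟨fun j => c j * m (u j), fun j => mul_pos (hc j) (hpos j), ?_⟩
      simp_rw [smul_smul, mul_assoc, mul_inv_cancel₀ (hpos _).ne', mul_one]
    · rintro ⟨c, hc, rfl⟩
      refine ⟨fun j => c j * (m (u j))⁻¹, fun j => mul_pos (hc j) (inv_pos.2 (hpos j)), ?_⟩
      simp_rw [smul_smul]
  · simp [(hpos j).ne']

/-- A limit of flats through points converging in the cone is a flat. -/
theorem IsDividedCone.exists_tendsto_flatForm [FiniteDimensional ℝ V]
    (h : IsDividedCone d C m Γ) {l : ℕ → V →L[ℝ] ℝ} (hl : ∀ n, IsFlatForm d C (l n))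
    (hl1 : ∀ n, ‖l n‖ = 1) {x : ℕ → V} {x₀ : V} (hx : Tendsto x atTop (nhds x₀)) (hx₀ : x₀ ∈ C)
    (hlx : ∀ n, l n (x n) = 0) :
    ∃ (φ : ℕ → ℕ) (l₀ : V →L[ℝ] ℝ), StrictMono φ ∧ Tendsto (l ∘ φ) atTop (nhds l₀) ∧
      ‖l₀‖ = 1 ∧ IsFlatForm d C l₀ ∧ l₀ x₀ = 0 := by
  have hC := h.proper
  choose u hu hum using fun n => (hl n).exists_basis hC
  have hu1 : ∀ n j, ‖u n j‖ ≤ 1 := fun n j =>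
    (hC.norm_le_closure ((hu n).basis_mem_closure j)).trans_eq (hum n j)
  have := FiniteDimensional.proper ℝ (V →L[ℝ] ℝ)
  have := FiniteDimensional.proper ℝ (Fin d → V)
  obtain ⟨⟨l₀, u₀⟩, -, φ, hφ, hlim⟩ := tendsto_subseq_of_bounded (x := fun n => (l n, u n))
    (isBounded_closedBall (x := (0 : (V →L[ℝ] ℝ) × (Fin d → V))) (r := 1))
    (fun n => by
      rw [mem_closedBall_zero_iff, Prod.norm_def]
      exact max_le (hl1 n).le ((pi_norm_le_iff_of_nonneg zero_le_one).2 (hu1 n)))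
  have hll : Tendsto (fun n => l (φ n)) atTop (nhds l₀) := (continuous_fst.tendsto _).comp hlim
  have huu : Tendsto (fun n => u (φ n)) atTop (nhds u₀) := (continuous_snd.tendsto _).comp hlim
  have huj : ∀ j, Tendsto (fun n => u (φ n) j) atTop (nhds (u₀ j)) := tendsto_pi_nhds.1 huu
  have happ : ∀ {y : ℕ → V} {y₀}, Tendsto y atTop (nhds y₀) →
      Tendsto (fun n => l (φ n) (y n)) atTop (nhds (l₀ y₀)) := fun {y y₀} hy =>
    (isBoundedBilinearMap_apply.continuous.tendsto (l₀, y₀)).comp (hll.prodMk_nhds hy)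
  have hl₀ : ‖l₀‖ = 1 := tendsto_nhds_unique hll.norm (by simp [hl1])
  have hl₀0 : l₀ ≠ 0 := by
    rintro rfl
    simp at hl₀
  have hlx₀ : l₀ x₀ = 0 :=
    tendsto_nhds_unique (happ (hx.comp hφ.tendsto_atTop)) (by simp [hlx])
  have hmu : ∀ j, m (u₀ j) = 1 := fun j =>
    tendsto_nhds_unique ((m.continuous.tendsto _).comp (huj j)) (by simp [Function.comp_def, hum])
  have huC : ∀ j, u₀ j ∈ closure C := fun j => by
    have := mem_closure_of_tendsto (huj j) (Eventually.of_forall fun n =>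
      (hu (φ n)).basis_mem_closure j)
    rwa [closure_closure] at this
  have hlu : ∀ j, l₀ (u₀ j) = 0 := fun j =>
    tendsto_nhds_unique (happ (huj j)) (by simp [(hu _).apply_eq_zero])
  obtain ⟨e, he⟩ : ∃ e, l₀ e ≠ 0 := by
    by_contra! hne
    exact hl₀0 (ContinuousLinearMap.ext hne)
  have hA : ∀ z ∈ C, l₀ z = 0 → ∃ c : Fin d → ℝ, (∀ j, 0 ≤ c j) ∧ z = ∑ j, c j • u₀ j := by
    intro z hz hlz
    let y : ℕ → V := fun n => z - (l (φ n) z / l (φ n) e) • e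
    have hy : Tendsto y atTop (nhds z) := by
      have h1 := (happ (tendsto_const_nhds (x := z))).div (happ (tendsto_const_nhds (x := e))) he
      have h2 := (tendsto_const_nhds (x := z)).sub (h1.smul_const e)
      rwa [hlz, zero_div, zero_smul, sub_zero] at h2
    have hev : ∀ᶠ n in atTop, y n ∈ C ∧ l (φ n) (y n) = 0 ∧ m (y n) < m z + 1 := by
      filter_upwards [hy.eventually (hC.isOpen.mem_nhds hz),
        (happ (tendsto_const_nhds (x := e))).eventually_ne he,
        ((m.continuous.tendsto _).comp hy).eventually_lt_const (lt_add_one (m z))] with n h1 h2 h3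
      exact ⟨h1, by simp [y, h2], h3⟩
    have hex : ∀ n, ∃ c : Fin d → ℝ, (∀ j, 0 ≤ c j) ∧ ‖c‖ ≤ m z + 1 ∧
        ((y n ∈ C ∧ l (φ n) (y n) = 0 ∧ m (y n) < m z + 1) → y n = ∑ j, c j • u (φ n) j) := by
      intro n
      have hmz : 0 < m z + 1 := by linarith [hC.pos hz]
      by_cases hn : y n ∈ C ∧ l (φ n) (y n) = 0 ∧ m (y n) < m z + 1
      · obtain ⟨c, hc, hce⟩ := ((hu (φ n)).2.2 _).1 ⟨hn.1, hn.2.1⟩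
        refine ⟨c, fun j => (hc j).le, (pi_norm_le_iff_of_nonneg hmz.le).2 fun j => ?_,
          fun _ => hce⟩
        have h3 := hn.2.2
        rw [hce, map_sum] at h3
        simp only [map_smul, hum, smul_eq_mul, mul_one] at h3
        rw [Real.norm_of_nonneg (hc j).le]
        exact (Finset.single_le_sum (fun i _ => (hc i).le) (Finset.mem_univ j)).trans h3.le
      · exact ⟨0, fun j => le_rfl, by simpa using hmz.le, fun h => (hn h).elim⟩
    choose c hc hcb hce using hex
    obtain ⟨c₀, -, ψ, hψ, hc₀⟩ := tendsto_subseq_of_bounded (x := c)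
      (isBounded_closedBall (x := (0 : Fin d → ℝ)) (r := m z + 1)) (fun n => by simpa using hcb n)
    have hcj : ∀ j, Tendsto (fun n => c (ψ n) j) atTop (nhds (c₀ j)) := tendsto_pi_nhds.1 hc₀
    refine ⟨c₀, fun j => ge_of_tendsto' (hcj j) fun n => hc _ j, ?_⟩
    have h1 : Tendsto (fun n => ∑ j, c (ψ n) j • u (φ (ψ n)) j) atTop (nhds (∑ j, c₀ j • u₀ j)) :=
      tendsto_finsetSum _ fun j _ => (hcj j).smul ((huj j).comp hψ.tendsto_atTop)
    refine tendsto_nhds_unique ((hy.comp hψ.tendsto_atTop).congr' ?_) h1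
    filter_upwards [hψ.tendsto_atTop.eventually hev] with n hn using hce _ hn
  have hspan : Submodule.span ℝ (range u₀) = LinearMap.ker (l₀ : V →ₗ[ℝ] ℝ) := by
    refine le_antisymm ?_ fun w hw => ?_
    · rw [Submodule.span_le]
      rintro _ ⟨j, rfl⟩
      exact hlu j
    have hw : l₀ w = 0 := hw
    obtain ⟨ε, hε, hs⟩ := hC.exists_pos_forall_add_smul_mem hx₀ w
    have h1 := hs (ε / 2) (by rw [abs_of_pos (half_pos hε)]; exact half_lt_self hε)
    obtain ⟨c, -, hc⟩ := hA _ h1 (by simp [hlx₀, hw])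
    obtain ⟨c', -, hc'⟩ := hA _ hx₀ hlx₀
    have hmem : ∀ b : Fin d → ℝ, ∑ j, b j • u₀ j ∈ Submodule.span ℝ (range u₀) := fun b =>
      Submodule.sum_mem _ fun j _ => Submodule.smul_mem _ _ (Submodule.subset_span ⟨j, rfl⟩)
    have h2 : (ε / 2) • w ∈ Submodule.span ℝ (range u₀) := by
      have := Submodule.sub_mem _ (hmem c) (hmem c')
      rwa [← hc, ← hc', add_sub_cancel_left] at this
    exact (Submodule.smul_mem_iff _ (half_pos hε).ne').1 h2
  have hind : LinearIndependent ℝ u₀ := by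
    rw [linearIndependent_iff_card_eq_finrank_span, Set.finrank, hspan, Fintype.card_fin]
    have h2 : Module.finrank ℝ (LinearMap.ker (l₀ : V →ₗ[ℝ] ℝ)) + 1 = Module.finrank ℝ V :=
      Module.Dual.finrank_ker_add_one_of_ne_zero (f := (l₀ : V →ₗ[ℝ] ℝ)) fun h =>
        hl₀0 (ContinuousLinearMap.coe_injective h)
    have := h.finrank_eq
    omega
  have hB : ∀ z ∈ C, l₀ z = 0 → ∃ c : Fin d → ℝ, (∀ j, 0 < c j) ∧ z = ∑ j, c j • u₀ j := by
    intro z hz hlz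
    obtain ⟨c, hc, hce⟩ := hA z hz hlz
    refine ⟨c, fun j => ?_, hce⟩
    obtain ⟨ε, hε, hs⟩ := hC.exists_pos_forall_add_smul_mem hz (u₀ j)
    have h1 := hs (-(ε / 2)) (by rw [abs_neg, abs_of_pos (half_pos hε)]; exact half_lt_self hε)
    obtain ⟨c', hc', hce'⟩ := hA _ h1 (by simp [hlz, hlu])
    have h2 : ∑ i, (c i - if i = j then ε / 2 else 0) • u₀ i = ∑ i, c' i • u₀ i := by
      rw [← hce', hce]
      simp_rw [sub_smul, Finset.sum_sub_distrib, ite_smul]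
      simp [sub_eq_add_neg]
    have h3 := congrFun (hind.fintypeLinearCombination_injective h2) j
    simp only [if_true] at h3
    linarith [hc' j]
  refine ⟨φ, l₀, hφ, hll, hl₀, ⟨u₀, hl₀0, hind, fun z => ⟨fun hz => hB z hz.1 hz.2, ?_⟩⟩, hlx₀⟩
  rintro ⟨c, hc, rfl⟩
  refine ⟨?_, by simp [hlu]⟩
  obtain ⟨b, hb, hbe⟩ := hB x₀ hx₀ hlx₀
  obtain ⟨ε, hε, hεc⟩ : ∃ ε : ℝ, 0 < ε ∧ ∀ j, ε * b j ≤ c j := by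
    have h1 : ∀ᶠ ε : ℝ in nhdsWithin 0 (Ioi 0), ∀ j, ε * b j < c j := by
      refine eventually_all.2 fun j => ?_
      have : Tendsto (fun ε : ℝ => ε * b j) (nhdsWithin 0 (Ioi 0)) (nhds (0 * b j)) :=
        ((by fun_prop : Continuous fun ε : ℝ => ε * b j).tendsto 0).mono_left nhdsWithin_le_nhds
      rw [zero_mul] at this
      exact this.eventually_lt_const (hc j)
    obtain ⟨ε, h2, h3⟩ := (h1.and self_mem_nhdsWithin).exists
    exact ⟨ε, h3, fun j => (h2 j).le⟩
  have h1 := hC.add_mem_of_closure (hC.closure_sum Finset.univ (fun j => (c j - ε * b j) • u₀ j)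
    fun j _ => hC.closure_smul (sub_nonneg.2 (hεc j)) (huC j)) (hC.smul_mem ε hε _ hx₀)
  convert h1 using 1
  rw [hbe, Finset.smul_sum, ← Finset.sum_add_distrib]
  refine Finset.sum_congr rfl fun j _ => ?_
  module

/-- A flat passing close to a point `b` of a given flat crosses every line transverse to that flat
close to it. -/
theorem IsDividedCone.eventually_crossing [FiniteDimensional ℝ V]
    (h : IsDividedCone d C m Γ) (hl : IsFlatForm d C l) {a b e : V} (ha : a ∈ C) (hb : b ∈ C)
    (hla : l a = 0) (hlb : l b = 0) (hle : l e ≠ 0) {η : ℝ} (hη : 0 < η) :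
    ∀ᶠ y in nhds b, ∀ l', IsFlatForm d C l' → l' y = 0 →
      ∃ t : ℝ, |t| < η ∧ a + t • e ∈ C ∧ l' (a + t • e) = 0 := by
  by_contra hcon
  rw [not_eventually] at hcon
  obtain ⟨y, hy, hcon⟩ := exists_seq_forall_of_frequently hcon
  push Not at hcon
  choose k hk hky hkt using hcon
  choose k' hk' hk1 hkk using fun n => (hk n).exists_unit
  obtain ⟨φ, l₀, hφ, hlim, -, hl₀, hl₀b⟩ := h.exists_tendsto_flatForm hk' hk1 hy hb
    fun n => (hkk n _).2 (hky n)
  have hker := h.ker_eq_of_common hl hl₀ (subset_closure hb) (h.proper.ne_zero hb) hlb hl₀b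
  have h1 : ∀ v, Tendsto (fun n => k' (φ n) v) atTop (nhds (l₀ v)) := fun v =>
    ((ContinuousLinearMap.apply ℝ ℝ v).continuous.tendsto l₀).comp hlim
  have he : l₀ e ≠ 0 := fun h0 => hle ((hker e).2 h0)
  have h2 : Tendsto (fun n => -(k' (φ n) a / k' (φ n) e)) atTop (nhds 0) := by
    have := ((h1 a).div (h1 e) he).neg
    rwa [(hker a).1 hla, zero_div, neg_zero] at this
  have h3 : Tendsto (fun n => a + (-(k' (φ n) a / k' (φ n) e)) • e) atTop (nhds a) := by
    have := (tendsto_const_nhds (x := a)).add (h2.smul_const e)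
    rwa [zero_smul, add_zero] at this
  have h4 := h2.abs
  rw [abs_zero] at h4
  obtain ⟨n, hn1, hn2, hn3⟩ := ((h4.eventually_lt_const hη).and
    ((h3.eventually (h.proper.isOpen.mem_nhds ha)).and ((h1 e).eventually_ne he))).exists
  refine hkt (φ n) _ hn1 hn2 ((hkk _ _).1 ?_)
  rw [map_add, map_smul, smul_eq_mul, neg_mul, div_mul_cancel₀ _ hn3, add_neg_cancel]

/-- A flat lies on one side of any other flat. -/
theorem IsDividedCone.pos_of_pos [FiniteDimensional ℝ V]
    (h : IsDividedCone d C m Γ) (hl : IsFlatForm d C l) (hl' : IsFlatForm d C l') {y y' : V}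
    (hy : y ∈ C) (hy' : y' ∈ C) (hly : l' y = 0) (hly' : l' y' = 0) (hpos : 0 < l y) :
    0 < l y' := by
  by_contra! hneg
  have hd : 0 < l y - l y' := by linarith
  have hz := h.proper.combo_mem hy hy' (s := l y / (l y - l y')) (by positivity)
    ((div_le_one hd).2 (by linarith))
  refine hpos.ne' ((h.ker_eq_of_common hl hl' (subset_closure hz) (h.proper.ne_zero hz)
    ?_ ?_ y).2 hly)
  · simp only [map_add, map_smul, smul_eq_mul]
    field_simp
    ring
  · simp [hly, hly']

/-- The union of the flats. -/
def flatSet (d : ℕ) (C : Set V) : Set V := {y | y ∈ C ∧ ∃ l, IsFlatForm d C l ∧ l y = 0}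

theorem IsDividedCone.mem_flatSet_of_tendsto [FiniteDimensional ℝ V]
    (h : IsDividedCone d C m Γ) {x : ℕ → V} {x₀ : V} (hx : Tendsto x atTop (nhds x₀))
    (hx₀ : x₀ ∈ C) (hX : ∀ n, x n ∈ flatSet d C) : x₀ ∈ flatSet d C := by
  choose k hk hkx using fun n => (hX n).2
  choose k' hk' hk1 hkk using fun n => (hk n).exists_unit
  obtain ⟨φ, l₀, hφ, hlim, -, hl₀, hl₀b⟩ := h.exists_tendsto_flatForm hk' hk1 hx hx₀
    fun n => (hkk n _).2 (hkx n)
  exact ⟨hx₀, l₀, hl₀, hl₀b⟩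

end

theorem exists_combo_eq_zero {x y : ℝ} (h : x * y < 0) :
    ∃ s : ℝ, 0 < s ∧ s < 1 ∧ (1 - s) * x + s * y = 0 := by
  have hne : x - y ≠ 0 := by
    intro h0
    rw [sub_eq_zero.1 h0] at h
    nlinarith [mul_self_nonneg y]
  have h2 : 0 < (x - y) ^ 2 := by positivity
  refine ⟨x / (x - y), ?_, ?_, by field_simp; ring⟩
  · rw [← mul_div_mul_right _ _ hne, ← sq]
    exact div_pos (by nlinarith [mul_self_nonneg x]) h2
  · rw [← mul_div_mul_right _ _ hne, ← sq, div_lt_one h2]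
    nlinarith [mul_self_nonneg y]

/-- There is a point `y` of the flat of `l'` with `x ≤ y ≤ R • x` for the order of the cone, where
`x` is a point of the flat of `l`. -/
def CloseAt (C : Set V) (R : ℝ) (l l' : V →L[ℝ] ℝ) (x : V) : Prop :=
  x ∈ C ∧ l x = 0 ∧ ∃ y ∈ C, l' y = 0 ∧ y - x ∈ closure C ∧ R • x - y ∈ closure C

/-- Two disjoint flats without any flat in between. -/
def AdjacentFlats (d : ℕ) (C : Set V) (l l' : V →L[ℝ] ℝ) : Prop :=
  IsFlatForm d C l ∧ IsFlatForm d C l' ∧ (∀ y ∈ C, l y = 0 → l' y ≠ 0) ∧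
    ∀ a ∈ C, ∀ b ∈ C, l a = 0 → l' b = 0 → ∀ s : ℝ, 0 < s → s < 1 →
      (1 - s) • a + s • b ∉ flatSet d C

section

variable {C : Set V} {m : V →L[ℝ] ℝ} {Γ : Subgroup (V ≃ₗ[ℝ] V)} {d : ℕ} {l l' : V →L[ℝ] ℝ}

theorem IsDividedCone.mul_pos_of_ne [FiniteDimensional ℝ V]
    (h : IsDividedCone d C m Γ) (hl : IsFlatForm d C l) (hl' : IsFlatForm d C l') {y y' : V}
    (hy : y ∈ C) (hy' : y' ∈ C) (hly : l' y = 0) (hly' : l' y' = 0) (hne : l y ≠ 0) :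
    0 < l y * l y' := by
  rcases hne.lt_or_gt with h0 | h0
  · have h1 := h.pos_of_pos (hl.smul (c := -1) (by norm_num)) hl' hy hy' hly hly' (by simpa)
    exact mul_pos_of_neg_of_neg h0 (by simpa using h1)
  · exact mul_pos h0 (h.pos_of_pos hl hl' hy hy' hly hly' h0)

theorem DividesCone.closure_mem [FiniteDimensional ℝ V] (hΓ : DividesCone C Γ) {γ : V ≃ₗ[ℝ] V}
    (hγ : γ ∈ Γ) {x : V} (hx : x ∈ closure C) : γ x ∈ closure C :=
  map_mem_closure (γ : V →ₗ[ℝ] V).continuous_of_finiteDimensional hx (hΓ.map_mem γ hγ)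

theorem IsFlatForm.exists_mem (h : IsFlatForm d C l) : ∃ a ∈ C, l a = 0 := by
  obtain ⟨u, hu⟩ := h
  exact ⟨_, hu.sum_one_mem, hu.apply_sum_one⟩

namespace CloseAt

variable {R : ℝ} {x : V}

theorem mono (hC : IsProperCone C m) (h : CloseAt C R l l' x) {R' : ℝ} (hR : R ≤ R') :
    CloseAt C R' l l' x := by
  obtain ⟨hx, hlx, y, hy, hly, h1, h2⟩ := h
  refine ⟨hx, hlx, y, hy, hly, h1, ?_⟩
  have := hC.closure_add h2 (hC.closure_smul (sub_nonneg.2 hR) (subset_closure hx))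
  convert this using 1
  module

theorem smul (hC : IsProperCone C m) (h : CloseAt C R l l' x) {s : ℝ} (hs : 0 < s) :
    CloseAt C R l l' (s • x) := by
  obtain ⟨hx, hlx, y, hy, hly, h1, h2⟩ := h
  refine ⟨hC.smul_mem s hs x hx, by simp [hlx], s • y, hC.smul_mem s hs y hy, by simp [hly], ?_, ?_⟩
  · rw [← smul_sub]
    exact hC.closure_smul hs.le h1
  · rw [smul_comm, ← smul_sub]
    exact hC.closure_smul hs.le h2

theorem congr (h : CloseAt C R l l' x) {k k' : V →L[ℝ] ℝ} (hk : ∀ z, l z = 0 → k z = 0)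
    (hk' : ∀ z, l' z = 0 → k' z = 0) : CloseAt C R k k' x := by
  obtain ⟨hx, hlx, y, hy, hly, h1, h2⟩ := h
  exact ⟨hx, hk _ hlx, y, hy, hk' _ hly, h1, h2⟩

theorem map [FiniteDimensional ℝ V] (hΓ : DividesCone C Γ) {γ : V ≃ₗ[ℝ] V} (hγ : γ ∈ Γ)
    (h : CloseAt C R l l' x) {k k' : V →L[ℝ] ℝ} (hk : ∀ z, k (γ z) = l z)
    (hk' : ∀ z, k' (γ z) = l' z) : CloseAt C R k k' (γ x) := by
  obtain ⟨hx, hlx, y, hy, hly, h1, h2⟩ := h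
  refine ⟨hΓ.map_mem γ hγ x hx, by rw [hk, hlx], γ y, hΓ.map_mem γ hγ y hy, by rw [hk', hly],
    ?_, ?_⟩
  · rw [← map_sub]
    exact hΓ.closure_mem hγ h1
  · rw [← map_smul, ← map_sub]
    exact hΓ.closure_mem hγ h2

end CloseAt

/-- The set of points of a flat close to a disjoint flat is compact modulo scaling. -/
theorem IsDividedCone.exists_tendsto_closeAt [FiniteDimensional ℝ V]
    (h : IsDividedCone d C m Γ) (hl : IsFlatForm d C l) (hl' : IsFlatForm d C l')
    (hdisj : ∀ y ∈ C, l y = 0 → l' y ≠ 0) {R : ℕ → ℝ} {R₀ : ℝ} (hR : Tendsto R atTop (nhds R₀))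
    {x : ℕ → V} (hm : ∀ n, m (x n) = 1) (hx : ∀ n, CloseAt C (R n) l l' (x n)) :
    ∃ (φ : ℕ → ℕ) (x₀ : V), StrictMono φ ∧ Tendsto (x ∘ φ) atTop (nhds x₀) ∧ m x₀ = 1 ∧
      CloseAt C R₀ l l' x₀ := by
  have hC := h.proper
  choose hxC hlx y hy hly h1 h2 using hx
  obtain ⟨B, hB⟩ := hR.bddAbove_range
  have hR' : ∀ n, R n ≤ B := fun n => hB ⟨n, rfl⟩
  have hxn : ∀ n, ‖x n‖ ≤ 1 := fun n => (hC.norm_le _ (hxC n)).trans_eq (hm n)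
  have hmy : ∀ n, m (y n) ≤ R n := fun n => by
    have := hC.nonneg_closure (h2 n)
    rw [map_sub, map_smul, hm, smul_eq_mul] at this
    linarith
  have hyn : ∀ n, ‖y n‖ ≤ max 1 B := fun n =>
    ((hC.norm_le _ (hy n)).trans ((hmy n).trans (hR' n))).trans (le_max_right _ _)
  have := FiniteDimensional.proper ℝ V
  obtain ⟨⟨x₀, y₀⟩, -, φ, hφ, hlim⟩ := tendsto_subseq_of_bounded (x := fun n => (x n, y n))
    (isBounded_closedBall (x := (0 : V × V)) (r := max 1 B))
    (fun n => by
      rw [mem_closedBall_zero_iff, Prod.norm_def]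
      exact max_le ((hxn n).trans (le_max_left _ _)) (hyn n))
  have hxx : Tendsto (fun n => x (φ n)) atTop (nhds x₀) := (continuous_fst.tendsto _).comp hlim
  have hyy : Tendsto (fun n => y (φ n)) atTop (nhds y₀) := (continuous_snd.tendsto _).comp hlim
  have hcl : ∀ {z : ℕ → V} {z₀}, Tendsto z atTop (nhds z₀) → (∀ n, z n ∈ closure C) →
      z₀ ∈ closure C := fun hz hzC => by
    have := mem_closure_of_tendsto hz (Eventually.of_forall hzC)
    rwa [closure_closure] at this
  have hx₀ := hcl hxx fun n => subset_closure (hxC _)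
  have hyx := hcl (hyy.sub hxx) fun n => h1 _
  have hxy := hcl (((hR.comp hφ.tendsto_atTop).smul hxx).sub hyy) fun n => h2 _
  have hlx₀ : l x₀ = 0 :=
    tendsto_nhds_unique ((l.continuous.tendsto _).comp hxx) (by simp [Function.comp_def, hlx])
  have hly₀ : l' y₀ = 0 :=
    tendsto_nhds_unique ((l'.continuous.tendsto _).comp hyy) (by simp [Function.comp_def, hly])
  have hm₀ : m x₀ = 1 :=
    tendsto_nhds_unique ((m.continuous.tendsto _).comp hxx) (by simp [Function.comp_def, hm])
  have hx₀C : x₀ ∈ C := by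
    by_contra hxC
    have hy₀ : y₀ ∈ closure C := by simpa using hC.closure_add hyx hx₀
    have hmy₀ : 1 ≤ m y₀ := by
      have := hC.nonneg_closure hyx
      rw [map_sub, hm₀] at this
      linarith
    have hRpos : 0 < R₀ := by
      have := hC.nonneg_closure hxy
      rw [map_sub, map_smul, hm₀, smul_eq_mul] at this
      linarith
    have hl0 : l y₀ = 0 := by
      refine h.apply_eq_zero_of_add hl hy₀ hxy ?_ (by simp [hlx₀])
      rw [add_sub_cancel, hC.smul_mem_iff hRpos]
      exact hxC
    obtain ⟨a, ha, hla⟩ := hl.exists_mem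
    refine hdisj a ha hla ((h.ker_eq_of_common hl hl' hy₀ ?_ hl0 hly₀ a).1 hla)
    rintro rfl
    rw [map_zero] at hmy₀
    linarith
  refine ⟨φ, x₀, hφ, hxx, hm₀, hx₀C, hlx₀, y₀, ?_, hly₀, hyx, hxy⟩
  simpa using hC.add_mem_of_closure hyx hx₀C

theorem IsProperCone.eventually_closeAt (hC : IsProperCone C m) {k : V} (hk : k ∈ C) {R : ℝ}
    (hR : 1 < R) : ∀ᶠ p : V × V in nhds (k, k), ∀ l l' : V →L[ℝ] ℝ, l p.1 = 0 → l' p.2 = 0 →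
      CloseAt C R l l' p.1 := by
  have h1 : ∀ᶠ p : V × V in nhds (k, k), p.1 ∈ C :=
    (hC.isOpen.preimage continuous_fst).mem_nhds hk
  have h2 : ∀ᶠ p : V × V in nhds (k, k), p.2 ∈ C :=
    (hC.isOpen.preimage continuous_snd).mem_nhds hk
  have h3 : ∀ᶠ p : V × V in nhds (k, k), ((1 + R) / 2) • p.2 - p.1 ∈ C := by
    refine (hC.isOpen.preimage (by fun_prop :
      Continuous fun p : V × V => ((1 + R) / 2) • p.2 - p.1)).mem_nhds ?_
    have e : ((1 + R) / 2) • k - k = ((R - 1) / 2) • k := by module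
    rw [mem_preimage, e]
    exact hC.smul_mem _ (by linarith) _ hk
  have h4 : ∀ᶠ p : V × V in nhds (k, k), R • p.1 - ((1 + R) / 2) • p.2 ∈ C := by
    refine (hC.isOpen.preimage (by fun_prop :
      Continuous fun p : V × V => R • p.1 - ((1 + R) / 2) • p.2)).mem_nhds ?_
    have e : R • k - ((1 + R) / 2) • k = ((R - 1) / 2) • k := by module
    rw [mem_preimage, e]
    exact hC.smul_mem _ (by linarith) _ hk
  filter_upwards [h1, h2, h3, h4] with p h1 h2 h3 h4 l l' hl hl'
  exact ⟨h1, hl, _, hC.smul_mem ((1 + R) / 2) (by linarith) _ h2, by simp [hl'],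
    subset_closure h3, subset_closure h4⟩

theorem CloseAt.eventually_of_two (hC : IsProperCone C m) {x : V} (h : CloseAt C 2 l l' x) :
    ∀ᶠ z in nhds x, l z = 0 → CloseAt C 4 l l' z := by
  obtain ⟨hx, hlx, y, hy, hly, h1, h2⟩ := h
  have h3 : ∀ᶠ z in nhds x, (3 / 2 : ℝ) • y - z ∈ C := by
    refine (hC.isOpen.preimage (by fun_prop :
      Continuous fun z => (3 / 2 : ℝ) • y - z)).mem_nhds ?_
    have e : (3 / 2 : ℝ) • y - x = (y - x) + (1 / 2 : ℝ) • y := by module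
    rw [mem_preimage, e]
    exact hC.add_mem_of_closure h1 (hC.smul_mem _ (by norm_num) _ hy)
  have h4 : ∀ᶠ z in nhds x, (4 : ℝ) • z - (3 / 2 : ℝ) • y ∈ C := by
    refine (hC.isOpen.preimage (by fun_prop :
      Continuous fun z => (4 : ℝ) • z - (3 / 2 : ℝ) • y)).mem_nhds ?_
    have e : (4 : ℝ) • x - (3 / 2 : ℝ) • y = (3 / 2 : ℝ) • ((2 : ℝ) • x - y) + x := by module
    rw [mem_preimage, e]
    exact hC.add_mem_of_closure (hC.closure_smul (by norm_num) h2) hx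
  filter_upwards [h3, h4, hC.isOpen.mem_nhds hx] with z h3 h4 hz hlz
  exact ⟨hz, hlz, _, hC.smul_mem (3 / 2) (by norm_num) _ hy, by simp [hly], subset_closure h3,
    subset_closure h4⟩

theorem tendsto_inv_smul_add_smul {p u : V} (hu : m u = 1) (hp : 0 < m p) :
    Tendsto (fun n : ℕ => (m (p + (n : ℝ) • u))⁻¹ • (p + (n : ℝ) • u)) atTop (nhds u) := by
  have h1 : Tendsto (fun n : ℕ => (m p + (n : ℝ))⁻¹) atTop (nhds 0) :=
    (tendsto_atTop_add_const_left _ _ tendsto_natCast_atTop_atTop).inv_tendsto_atTop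
  have h2 : Tendsto (fun n : ℕ => (m p + (n : ℝ))⁻¹ • (p - m p • u) + u) atTop
      (nhds ((0 : ℝ) • (p - m p • u) + u)) := (h1.smul_const _).add tendsto_const_nhds
  rw [zero_smul, zero_add] at h2
  refine h2.congr fun n => ?_
  rw [map_add, map_smul, hu, smul_eq_mul, mul_one,
    show p + (n : ℝ) • u = (p - m p • u) + (m p + n) • u by module, smul_add, smul_smul,
    inv_mul_cancel₀ (by positivity), one_smul]

/-- Two disjoint flats drift apart. -/
theorem IsDividedCone.exists_closeAt_four_not_two [FiniteDimensional ℝ V]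
    (h : IsDividedCone d C m Γ) (hl : IsFlatForm d C l) (hl' : IsFlatForm d C l')
    (hdisj : ∀ y ∈ C, l y = 0 → l' y ≠ 0) {p : V} (hp : CloseAt C 2 l l' p) :
    ∃ x, CloseAt C 4 l l' x ∧ ¬ CloseAt C 2 l l' x := by
  have hC := h.proper
  by_contra! hcon
  obtain ⟨u, hu, hum⟩ := hl.exists_basis hC
  have hd := h.three_le
  let i : Fin d := ⟨0, by omega⟩
  have hpu : ∀ s : ℝ, 0 ≤ s → p + s • u i ∈ C := fun s hs => by
    rw [add_comm]
    exact hC.add_mem_of_closure (hC.closure_smul hs (hu.basis_mem_closure i)) hp.1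
  have hlu : ∀ s : ℝ, l (p + s • u i) = 0 := fun s => by simp [hp.2.1, hu.apply_eq_zero]
  have hmu : ∀ s : ℝ, m (p + s • u i) = m p + s := fun s => by simp [hum]
  have hmp := hC.pos hp.1
  have hall : ∀ b : ℝ, 0 ≤ b → CloseAt C 2 l l' (p + b • u i) := by
    intro b hb
    have hsub := IsClosed.Icc_subset_of_forall_exists_gt (a := (0 : ℝ)) (b := b)
      (s := {s | CloseAt C 2 l l' (p + s • u i)}) ?_ (by simpa using hp) ?_
    · exact hsub ⟨hb, le_rfl⟩
    · refine IsSeqClosed.isClosed fun s s₀ hs hs₀ => ?_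
      have hs₀' := isClosed_Icc.mem_of_tendsto hs₀ (Eventually.of_forall fun n => (hs n).2)
      refine ⟨?_, hs₀'⟩
      obtain ⟨φ, x₀, hφ, hx₀, -, hclose⟩ := h.exists_tendsto_closeAt hl hl' hdisj
        (tendsto_const_nhds (x := (2 : ℝ)))
        (x := fun n => (m p + s n)⁻¹ • (p + s n • u i)) (fun n => by
          rw [map_smul, hmu, smul_eq_mul, inv_mul_cancel₀]
          linarith [(hs n).2.1]) fun n => (hs n).1.smul hC (inv_pos.2 (by linarith [(hs n).2.1]))
      have h1 : Tendsto (fun n => (m p + s n) • ((m p + s n)⁻¹ • (p + s n • u i))) atTop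
          (nhds (p + s₀ • u i)) := by
        have : ∀ n, (m p + s n) • ((m p + s n)⁻¹ • (p + s n • u i)) = p + s n • u i := fun n => by
          rw [smul_smul, mul_inv_cancel₀, one_smul]
          linarith [(hs n).2.1]
        simp_rw [this]
        exact tendsto_const_nhds.add (hs₀.smul_const _)
      have h2 : Tendsto (fun n => (m p + s (φ n)) • ((m p + s (φ n))⁻¹ • (p + s (φ n) • u i)))
          atTop (nhds ((m p + s₀) • x₀)) :=
        (tendsto_const_nhds.add (hs₀.comp hφ.tendsto_atTop)).smul hx₀
      rw [mem_ofPred_eq, tendsto_nhds_unique (h1.comp hφ.tendsto_atTop) h2]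
      exact hclose.smul hC (by linarith [hs₀'.1])
    · rintro s ⟨hs, hs0, -⟩ t hst
      have h1 : Tendsto (fun r : ℝ => p + r • u i) (nhdsWithin s (Ioi s))
          (nhds (p + s • u i)) :=
        ((by fun_prop : Continuous fun r : ℝ => p + r • u i).tendsto s).mono_left
          nhdsWithin_le_nhds
      obtain ⟨r, hr, hr'⟩ := ((h1.eventually (hs.eventually_of_two hC)).and
        (Ioc_mem_nhdsGT hst)).exists
      exact ⟨r, hcon _ (hr (hlu r)), hr'⟩
  have hmn : ∀ n : ℕ, 0 < m (p + (n : ℝ) • u i) := fun n => by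
    rw [hmu]
    positivity
  obtain ⟨φ, x₀, hφ, hx₀, -, hclose⟩ := h.exists_tendsto_closeAt hl hl' hdisj
    (tendsto_const_nhds (x := (2 : ℝ)))
    (x := fun n : ℕ => (m (p + (n : ℝ) • u i))⁻¹ • (p + (n : ℝ) • u i)) (fun n => by
      rw [map_smul, smul_eq_mul, inv_mul_cancel₀ (hmn n).ne'])
    fun n => (hall n n.cast_nonneg).smul hC (inv_pos.2 (hmn n))
  rw [tendsto_nhds_unique hx₀
    ((tendsto_inv_smul_add_smul (hum i) hmp).comp hφ.tendsto_atTop)] at hclose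
  exact hu.basis_notMem hd i hclose.1

end

section

variable {C : Set V} {m : V →L[ℝ] ℝ} {Γ : Subgroup (V ≃ₗ[ℝ] V)} {d : ℕ} {l l' : V →L[ℝ] ℝ}

theorem IsFlatForm.exists_apply_ne_zero (h : IsFlatForm d C l) : ∃ e, l e ≠ 0 := by
  by_contra! h0
  exact h.choose_spec.1 (ContinuousLinearMap.ext h0)

theorem pullForm_inv_apply [FiniteDimensional ℝ V] (γ : V ≃ₗ[ℝ] V) (l : V →L[ℝ] ℝ) (z : V) :
    pullForm γ⁻¹ l (γ z) = l z := by
  rw [pullForm_apply]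
  exact congrArg l (γ.symm_apply_apply z)

theorem map_mem_flatSet [FiniteDimensional ℝ V] (hΓ : DividesCone C Γ) {γ : V ≃ₗ[ℝ] V}
    (hγ : γ ∈ Γ) {y : V} (hy : y ∈ flatSet d C) : γ y ∈ flatSet d C := by
  obtain ⟨hyC, q, hq, hqy⟩ := hy
  exact ⟨hΓ.map_mem γ hγ y hyC, pullForm γ⁻¹ q, hq.pullForm hΓ (Γ.inv_mem hγ), by
    rw [pullForm_inv_apply, hqy]⟩

namespace AdjacentFlats

theorem pullForm [FiniteDimensional ℝ V] (h : AdjacentFlats d C l l') (hΓ : DividesCone C Γ)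
    {γ : V ≃ₗ[ℝ] V} (hγ : γ ∈ Γ) : AdjacentFlats d C (pullForm γ l) (pullForm γ l') := by
  obtain ⟨hl, hl', hdisj, hbt⟩ := h
  refine ⟨hl.pullForm hΓ hγ, hl'.pullForm hΓ hγ, fun y hy => hdisj _ (hΓ.map_mem γ hγ y hy), ?_⟩
  intro a ha b hb hla hlb s hs0 hs1 hmem
  refine hbt _ (hΓ.map_mem γ hγ a ha) _ (hΓ.map_mem γ hγ b hb) hla hlb s hs0 hs1 ?_
  simpa using map_mem_flatSet hΓ hγ hmem

/-- Two flats are adjacent as soon as one segment joining them meets no other flat. -/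
theorem of_segment [FiniteDimensional ℝ V] (h : IsDividedCone d C m Γ) (hl : IsFlatForm d C l)
    (hl' : IsFlatForm d C l') {a b : V} (ha : a ∈ C) (hb : b ∈ C) (hla : l a = 0) (hlb : l' b = 0)
    (hne : l b ≠ 0) (hseg : ∀ s : ℝ, 0 < s → s < 1 → (1 - s) • a + s • b ∉ flatSet d C) :
    AdjacentFlats d C l l' := by
  have hC := h.proper
  have hdisj : ∀ y ∈ C, l y = 0 → l' y ≠ 0 := fun y hy h1 h2 =>
    hne ((h.ker_eq_of_common hl hl' (subset_closure hy) (hC.ne_zero hy) h1 h2 b).2 hlb)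
  refine ⟨hl, hl', hdisj, ?_⟩
  rintro a' ha' b' hb' hla' hlb' s hs0 hs1 ⟨hz, q, hq, hqz⟩
  have hqa : q a' ≠ 0 := fun h0 => by
    have h1 := (h.ker_eq_of_common hq hl (subset_closure ha') (hC.ne_zero ha') h0 hla' _).1 hqz
    exact hdisj b' hb' (by simpa [hla', hs0.ne'] using h1) hlb'
  have e : (1 - s) * q a' + s * q b' = 0 := by simpa using hqz
  have hqb : q b' ≠ 0 := fun h0 => by
    rw [h0, mul_zero, add_zero] at e
    exact (mul_ne_zero (by linarith) hqa) e
  have h3 := h.mul_pos_of_ne hq hl ha' ha hla' hla hqa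
  have h4 := h.mul_pos_of_ne hq hl' hb' hb hlb' hlb hqb
  have h5 : q a * q b < 0 := by
    have h6 : q a' * q b' < 0 := by
      have : s * (q a' * q b') = -((1 - s) * (q a' * q a')) := by linear_combination q a' * e
      have h7 : 0 < (1 - s) * (q a' * q a') :=
        mul_pos (by linarith) (mul_self_pos.2 hqa)
      nlinarith
    by_contra! h7
    nlinarith [mul_pos h3 h4]
  obtain ⟨t, ht0, ht1, ht⟩ := exists_combo_eq_zero h5
  exact hseg t ht0 ht1 ⟨hC.combo_mem ha hb ht0.le ht1.le, q, hq, by simpa using ht⟩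

end AdjacentFlats

theorem CloseAt.pullForm_inv_iff [FiniteDimensional ℝ V] (hΓ : DividesCone C Γ)
    {γ : V ≃ₗ[ℝ] V} (hγ : γ ∈ Γ) {R : ℝ} {x : V} :
    CloseAt C R (pullForm γ⁻¹ l) (pullForm γ⁻¹ l') (γ x) ↔ CloseAt C R l l' x := by
  refine ⟨fun hx => ?_, fun hx => hx.map hΓ hγ (pullForm_inv_apply γ l) (pullForm_inv_apply γ l')⟩
  have := hx.map hΓ (Γ.inv_mem hγ) (k := l) (k' := l') (fun _ => rfl) (fun _ => rfl)
  rwa [show γ⁻¹ (γ x) = x from γ.symm_apply_apply x] at this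

theorem CloseAt.smul_iff (hC : IsProperCone C m) {R : ℝ} {x : V} {s : ℝ} (hs : 0 < s) :
    CloseAt C R l l' (s • x) ↔ CloseAt C R l l' x := by
  refine ⟨fun hx => ?_, fun hx => hx.smul hC hs⟩
  simpa [smul_smul, inv_mul_cancel₀ hs.ne'] using hx.smul hC (inv_pos.2 hs)

theorem IsDividedCone.closeAt_of_tendsto [FiniteDimensional ℝ V] (h : IsDividedCone d C m Γ)
    {l l' : ℕ → V →L[ℝ] ℝ} {x y z : ℕ → V} {R : ℕ → ℝ} {x₀ y₀ : V}
    (hadj : ∀ n, AdjacentFlats d C (l n) (l' n)) (hx : Tendsto x atTop (nhds x₀)) (hx₀ : x₀ ∈ C)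
    (hy : Tendsto y atTop (nhds y₀)) (hy₀ : y₀ ∈ C) (hxC : ∀ n, x n ∈ C) (hyC : ∀ n, y n ∈ C)
    (hlx : ∀ n, l n (x n) = 0) (hly : ∀ n, l' n (y n) = 0) (hR : Tendsto R atTop (nhds 1))
    (hmz : ∀ n, m (z n) = 1) (hz : ∀ n, CloseAt C (R n) (l n) (l' n) (z n)) :
    ∃ n, CloseAt C 2 (l n) (l' n) (x n) := by
  have hC := h.proper
  obtain ⟨-, k, hk, hkx⟩ := h.mem_flatSet_of_tendsto hx hx₀ fun n => ⟨hxC n, _, (hadj n).1, hlx n⟩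
  obtain ⟨-, k', hk', hky⟩ :=
    h.mem_flatSet_of_tendsto hy hy₀ fun n => ⟨hyC n, _, (hadj n).2.1, hly n⟩
  by_cases hky₀ : k y₀ = 0
  · obtain ⟨e, he⟩ := hk.exists_apply_ne_zero
    have h1 : Tendsto (fun p : ℕ × ℝ => (x p.1, x₀ + p.2 • e)) (atTop ×ˢ nhds 0)
        (nhds (x₀, x₀)) := by
      refine (hx.comp tendsto_fst).prodMk_nhds ?_
      have : Tendsto (fun t : ℝ => x₀ + t • e) (nhds 0) (nhds (x₀ + (0 : ℝ) • e)) :=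
        (by fun_prop : Continuous fun t : ℝ => x₀ + t • e).tendsto 0
      rw [zero_smul, add_zero] at this
      exact this.comp tendsto_snd
    obtain ⟨pa, hpa, pb, hpb, hp⟩ := eventually_prod_iff.1
      (h1.eventually (hC.eventually_closeAt hx₀ one_lt_two))
    obtain ⟨η, hη, hη'⟩ := Metric.eventually_nhds_iff.1 hpb
    obtain ⟨n, hn, hn'⟩ := (hpa.and (hy.eventually
      (h.eventually_crossing hk hx₀ hy₀ hkx hky₀ he hη))).exists
    obtain ⟨t, ht, -, ht'⟩ := hn' _ (hadj n).2.1 (hly n)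
    exact ⟨n, hp hn (hη' (by simpa using ht)) _ _ (hlx n) ht'⟩
  · exfalso
    have hkx₀ : k' x₀ ≠ 0 := fun h0 => hky₀
      ((h.ker_eq_of_common hk hk' (subset_closure hx₀) (hC.ne_zero hx₀) hkx h0 _).2 hky)
    obtain ⟨N, hN⟩ := eventually_atTop.1 ((hx.eventually (h.eventually_crossing hk hx₀ hx₀ hkx hkx
      (e := y₀ - x₀) (by simpa [hkx]) (η := 1 / 2) (by norm_num))).and (hy.eventually
      (h.eventually_crossing hk' hy₀ hy₀ hky hky (e := y₀ - x₀) (by simpa [hky])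
      (η := 1 / 2) (by norm_num))))
    choose s hs hsC hls using fun n => (hN (N + n) (Nat.le_add_right _ _)).1 _ (hadj _).1 (hlx _)
    choose t ht htC hlt using fun n => (hN (N + n) (Nat.le_add_right _ _)).2 _ (hadj _).2.1 (hly _)
    have hb : ∀ n r, s n < r → r < 1 + t n → x₀ + r • (y₀ - x₀) ∉ flatSet d C := by
      intro n r h1 h2 h3
      have hpos : 0 < 1 + t n - s n := by linarith
      refine (hadj (N + n)).2.2.2 _ (hsC n) _ (htC n) (hls n) (hlt n)
        ((r - s n) / (1 + t n - s n)) (div_pos (by linarith) hpos)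
        ((div_lt_one hpos).2 (by linarith)) ?_
      convert h3 using 1
      have e1 : r = s n + ((r - s n) / (1 + t n - s n)) * (1 + t n - s n) := by
        field_simp
        ring
      generalize (r - s n) / (1 + t n - s n) = c at e1
      rw [e1]
      module
    have hs_le : ∀ n k, s k ≤ s n := fun n k => by
      by_contra! h1
      exact hb n (s k) h1 (by linarith [(abs_lt.1 (hs k)).2, (abs_lt.1 (ht n)).1])
        ⟨hsC k, _, (hadj _).1, hls k⟩
    have ht_le : ∀ n k, t n ≤ t k := fun n k => by
      by_contra! h1
      refine hb n (1 + t k) (by linarith [(abs_lt.1 (hs n)).2, (abs_lt.1 (ht k)).1]) (by linarith)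
        ⟨?_, _, (hadj (N + k)).2.1, ?_⟩
      · convert htC k using 1
        module
      · convert hlt k using 2
        module
    have hker : ∀ n w, l (N + n) w = 0 → l (N + 0) w = 0 := fun n w hw => by
      have h1 := hls n
      rw [le_antisymm (hs_le 0 n) (hs_le n 0)] at h1
      exact (h.ker_eq_of_common (hadj _).1 (hadj _).1 (subset_closure (hsC 0))
        (hC.ne_zero (hsC 0)) h1 (hls 0) w).1 hw
    have hker' : ∀ n w, l' (N + n) w = 0 → l' (N + 0) w = 0 := fun n w hw => by
      have h1 := hlt n
      rw [le_antisymm (ht_le n 0) (ht_le 0 n)] at h1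
      exact (h.ker_eq_of_common (hadj _).2.1 (hadj _).2.1 (subset_closure (htC 0))
        (hC.ne_zero (htC 0)) h1 (hlt 0) w).1 hw
    have hNR : Tendsto (fun n => R (N + n)) atTop (nhds 1) := by
      simpa [add_comm] using (tendsto_add_atTop_iff_nat N).2 hR
    obtain ⟨φ, z₀, -, -, hmz₀, hzC, hlz, w, hw, hlw, h1, h2⟩ := h.exists_tendsto_closeAt
      (hadj (N + 0)).1 (hadj (N + 0)).2.1 (hadj (N + 0)).2.2.1 hNR (fun n => hmz (N + n))
      fun n => (hz (N + n)).congr (hker n) (hker' n)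
    have h3 : w = z₀ := by
      rw [one_smul] at h2
      have h4 := hC.nonneg_closure h2
      have h5 := hC.norm_le_closure h1
      rw [map_sub] at h4 h5
      have : ‖w - z₀‖ = 0 := le_antisymm (by linarith) (norm_nonneg _)
      exact sub_eq_zero.1 (norm_eq_zero.1 this)
    exact (hadj (N + 0)).2.2.1 z₀ hzC hlz (h3 ▸ hlw)

/-- Adjacent flats are uniformly far from each other. -/
theorem IsDividedCone.exists_not_closeAt [FiniteDimensional ℝ V] (h : IsDividedCone d C m Γ) :
    ∃ R : ℝ, 1 < R ∧ ∀ l l', AdjacentFlats d C l l' → ∀ x, ¬ CloseAt C R l l' x := by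
  have hC := h.proper
  obtain ⟨K, hKC, hK, hcov⟩ := h.divides.cocompact
  by_contra! hcon
  have key : ∀ n : ℕ, ∃ l l' x y z, AdjacentFlats d C l l' ∧ x ∈ K ∧ l x = 0 ∧ y ∈ C ∧ l' y = 0 ∧
      y - x ∈ closure C ∧ (4 : ℝ) • x - y ∈ closure C ∧ ¬ CloseAt C 2 l l' x ∧ m z = 1 ∧
      CloseAt C (1 + 1 / ((n : ℝ) + 1)) l l' z := by
    intro n
    obtain ⟨l, l', hadj, z, hz⟩ := hcon (1 + 1 / ((n : ℝ) + 1)) (by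
      have : 0 < 1 / ((n : ℝ) + 1) := by positivity
      linarith)
    obtain ⟨x, hx4, hx2⟩ := h.exists_closeAt_four_not_two hadj.1 hadj.2.1 hadj.2.2.1
      (hz.mono hC (R' := 2) (by
        have : 1 / ((n : ℝ) + 1) ≤ 1 := by
          rw [div_le_one (by positivity)]
          linarith [n.cast_nonneg (α := ℝ)]
        linarith))
    obtain ⟨γ, hγ, s, hs, hsK⟩ := hcov x hx4.1
    have hx4' := ((CloseAt.pullForm_inv_iff h.divides hγ).2 hx4).smul hC hs
    have hz' := (CloseAt.pullForm_inv_iff h.divides hγ).2 hz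
    obtain ⟨-, hlx, y, hy, hly, h1, h2⟩ := hx4'
    refine ⟨_, _, s • γ x, y, (m (γ z))⁻¹ • γ z, hadj.pullForm h.divides (Γ.inv_mem hγ), hsK, hlx,
      hy, hly, h1, h2, ?_, ?_, hz'.smul hC (inv_pos.2 (hC.pos hz'.1))⟩
    · rwa [CloseAt.smul_iff hC hs, CloseAt.pullForm_inv_iff h.divides hγ]
    · rw [map_smul, smul_eq_mul, inv_mul_cancel₀ (hC.pos hz'.1).ne']
  choose l l' x y z hadj hxK hlx hyC hly h1 h2 hnot hmz hz using key
  have := FiniteDimensional.proper ℝ V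
  obtain ⟨x₀, hx₀, φ, hφ, hx⟩ := hK.tendsto_subseq hxK
  obtain ⟨B, hB⟩ := hK.isBounded.exists_norm_le
  have hyb : ∀ n, ‖y n‖ ≤ ‖m‖ * (4 * B) := fun n => by
    have h3 := hC.nonneg_closure (h2 n)
    rw [map_sub, map_smul, smul_eq_mul] at h3
    calc ‖y n‖ ≤ m (y n) := hC.norm_le _ (hyC n)
      _ ≤ 4 * m (x n) := by linarith
      _ ≤ 4 * (‖m‖ * ‖x n‖) := by
        gcongr
        exact (le_abs_self _).trans (m.le_opNorm _)
      _ ≤ 4 * (‖m‖ * B) := by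
        gcongr
        exact hB _ (hxK n)
      _ = _ := by ring
  obtain ⟨y₀, -, ψ, hψ, hy⟩ := tendsto_subseq_of_bounded (x := y ∘ φ)
    (isBounded_closedBall (x := (0 : V)) (r := ‖m‖ * (4 * B)))
    fun n => by simpa using hyb (φ n)
  have hx' := hx.comp hψ.tendsto_atTop
  have hy₀ : y₀ ∈ C := by
    have h3 : y₀ - x₀ ∈ closure C := by
      have := mem_closure_of_tendsto (hy.sub hx') (Eventually.of_forall fun n => h1 _)
      rwa [closure_closure] at this
    simpa using hC.add_mem_of_closure h3 (hKC hx₀)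
  have hR : Tendsto (fun n : ℕ => 1 + 1 / ((n : ℝ) + 1)) atTop (nhds 1) := by
    simpa using (tendsto_one_div_add_atTop_nhds_zero_nat (𝕜 := ℝ)).const_add 1
  obtain ⟨n, hn⟩ := h.closeAt_of_tendsto (fun n => hadj (φ (ψ n))) hx' (hKC hx₀) hy hy₀
    (fun n => hKC (hxK _)) (fun n => hyC _) (fun n => hlx _) (fun n => hly _)
    (hR.comp (hφ.tendsto_atTop.comp hψ.tendsto_atTop)) (fun n => hmz _) fun n => hz _
  exact hnot _ hn

end

section

variable {C : Set V} {m : V →L[ℝ] ℝ} {Γ : Subgroup (V ≃ₗ[ℝ] V)} {d : ℕ} {l l' : V →L[ℝ] ℝ}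

theorem tendsto_add_smul (p e : V) : Tendsto (fun t : ℝ => p + t • e) (nhds 0) (nhds p) := by
  have := (by fun_prop : Continuous fun t : ℝ => p + t • e).tendsto 0
  simpa using this

theorem IsProperCone.exists_pos_closeAt (hC : IsProperCone C m) {p : V} (hp : p ∈ C) (e : V)
    {R : ℝ} (hR : 1 < R) : ∃ η > 0, ∀ s t : ℝ, |s| < η → |t| < η → p + s • e ∈ C ∧
      ∀ l l' : V →L[ℝ] ℝ, l (p + s • e) = 0 → l' (p + t • e) = 0 →
        CloseAt C R l l' (p + s • e) := by
  have h1 := (((tendsto_add_smul p e).comp tendsto_fst).prodMk_nhds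
    ((tendsto_add_smul p e).comp tendsto_snd)).eventually (hC.eventually_closeAt hp hR)
  obtain ⟨pa, hpa, pb, hpb, hpq⟩ := eventually_prod_iff.1 h1
  obtain ⟨η₁, hη₁, h₁⟩ := Metric.eventually_nhds_iff.1
    (hpa.and ((tendsto_add_smul p e).eventually (hC.isOpen.mem_nhds hp)))
  obtain ⟨η₂, hη₂, h₂⟩ := Metric.eventually_nhds_iff.1 hpb
  refine ⟨min η₁ η₂, lt_min hη₁ hη₂, fun s t hs ht => ?_⟩
  have h3 := h₁ (y := s) (by simpa using hs.trans_le (min_le_left _ _))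
  have h4 := h₂ (y := t) (by simpa using ht.trans_le (min_le_right _ _))
  exact ⟨h3.2, fun l l' => hpq h3.1 h4 l l'⟩

/-- On a line, two consecutive points covered by flats cannot be close to each other. -/
theorem IsDividedCone.false_of_gap [FiniteDimensional ℝ V] (h : IsDividedCone d C m Γ) {R : ℝ}
    (hR : ∀ l l', AdjacentFlats d C l l' → ∀ x, ¬ CloseAt C R l l' x) {p e : V} {s t : ℝ}
    (hst : s < t) (hl : IsFlatForm d C l) (hl' : IsFlatForm d C l') (hle : l e ≠ 0)
    (hls : l (p + s • e) = 0) (hlt : l' (p + t • e) = 0) (ht : p + t • e ∈ C)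
    (hclose : CloseAt C R l l' (p + s • e))
    (hgap : ∀ r, s < r → r < t → p + r • e ∉ flatSet d C) : False := by
  refine hR l l' (AdjacentFlats.of_segment h hl hl' hclose.1 ht hls hlt ?_ ?_) _ hclose
  · have : l (p + t • e) = (t - s) * l e := by
      simp only [map_add, map_smul, smul_eq_mul] at hls ⊢
      linear_combination hls
    rw [this]
    exact mul_ne_zero (by linarith) hle
  · intro r hr0 hr1
    have : (1 - r) • (p + s • e) + r • (p + t • e) = p + (s + r * (t - s)) • e := by module
    rw [this]
    exact hgap _ (by nlinarith) (by nlinarith)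

theorem isCompact_covered [FiniteDimensional ℝ V] (h : IsDividedCone d C m Γ) {p e : V}
    {s t : ℝ} (hC : ∀ r ∈ Icc s t, p + r • e ∈ C) :
    IsCompact {r | r ∈ Icc s t ∧ p + r • e ∈ flatSet d C} := by
  refine isCompact_Icc.of_isClosed_subset (IsSeqClosed.isClosed fun r r₀ hr hr₀ => ?_)
    fun r hr => hr.1
  have h1 := isClosed_Icc.mem_of_tendsto hr₀ (Eventually.of_forall fun n => (hr n).1)
  refine ⟨h1, h.mem_flatSet_of_tendsto (tendsto_const_nhds.add (hr₀.smul_const e)) (hC _ h1)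
    fun n => (hr n).2⟩

/-- The flat of `l` which is accumulated by no other flat on its positive side. -/
def OneSidedFlat (d : ℕ) (C : Set V) (l : V →L[ℝ] ℝ) : Prop :=
  IsFlatForm d C l ∧ ∀ a ∈ C, l a = 0 → ∀ᶠ y in nhds a, 0 < l y → y ∉ flatSet d C

namespace OneSidedFlat

theorem of_line [FiniteDimensional ℝ V] (h : IsDividedCone d C m Γ) (hl : IsFlatForm d C l)
    {a e : V} (ha : a ∈ C) (hla : l a = 0) (hle : 0 < l e) {η : ℝ} (hη : 0 < η)
    (hfree : ∀ t, 0 < t → t < η → a + t • e ∉ flatSet d C) : OneSidedFlat d C l := by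
  refine ⟨hl, fun b hb hlb => ?_⟩
  filter_upwards [h.eventually_crossing hl ha hb hla hlb hle.ne' hη] with y hy hly ⟨hyC, q, hq, hqy⟩
  obtain ⟨t, ht, htC, hqt⟩ := hy q hq hqy
  have h1 := h.pos_of_pos hl hq hyC htC hqy hqt hly
  rw [map_add, map_smul, hla, zero_add, smul_eq_mul] at h1
  exact hfree t (pos_of_mul_pos_left h1 hle.le) (abs_lt.1 ht).2 ⟨htC, q, hq, hqt⟩

theorem pullForm [FiniteDimensional ℝ V] (hl : OneSidedFlat d C l) (hΓ : DividesCone C Γ)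
    {γ : V ≃ₗ[ℝ] V} (hγ : γ ∈ Γ) : OneSidedFlat d C (pullForm γ l) := by
  refine ⟨hl.1.pullForm hΓ hγ, fun a ha hla => ?_⟩
  have h1 := hl.2 (γ a) (hΓ.map_mem γ hγ a ha) hla
  filter_upwards [((γ : V →ₗ[ℝ] V).continuous_of_finiteDimensional.tendsto a).eventually h1]
    with y hy hly hyX
  exact hy hly (map_mem_flatSet hΓ hγ hyX)

theorem smul (hl : OneSidedFlat d C l) {c : ℝ} (hc : 0 < c) : OneSidedFlat d C (c • l) := by
  refine ⟨hl.1.smul hc.ne', fun a ha hla => ?_⟩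
  filter_upwards [hl.2 a ha (by simpa [hc.ne'] using hla)] with y hy hly
  exact hy (pos_of_mul_pos_right (by simpa using hly) hc.le)

theorem exists_unit (hl : OneSidedFlat d C l) :
    ∃ k, OneSidedFlat d C k ∧ ‖k‖ = 1 ∧ ∀ z, k z = 0 ↔ l z = 0 := by
  have h0 : 0 < ‖l‖ := norm_pos_iff.2 hl.1.choose_spec.1
  refine ⟨‖l‖⁻¹ • l, hl.smul (inv_pos.2 h0), ?_, fun z => by simp [h0.ne']⟩
  rw [norm_smul, norm_inv, norm_norm, inv_mul_cancel₀ h0.ne']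

/-- Two flats, isolated on the same side, which cross a short transversal agree. -/
theorem le_of_close [FiniteDimensional ℝ V] (h : IsDividedCone d C m Γ) {R : ℝ}
    (hR : ∀ l l', AdjacentFlats d C l l' → ∀ x, ¬ CloseAt C R l l' x) (hl : OneSidedFlat d C l)
    {p e : V} {η : ℝ} (hη : ∀ s t : ℝ, |s| < η → |t| < η → p + s • e ∈ C ∧
      ∀ l l' : V →L[ℝ] ℝ, l (p + s • e) = 0 → l' (p + t • e) = 0 →
        CloseAt C R l l' (p + s • e)) {s t : ℝ} (hs : |s| < η) (ht : |t| < η) (hle : 0 < l e)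
    (hls : l (p + s • e) = 0) (htX : p + t • e ∈ flatSet d C) : t ≤ s := by
  by_contra! hst
  have hsC := (hη s t hs ht).1
  have habs : ∀ r ∈ Icc s t, |r| < η := fun r hr =>
    abs_lt.2 ⟨(abs_lt.1 hs).1.trans_le hr.1, hr.2.trans_lt (abs_lt.1 ht).2⟩
  obtain ⟨δ, hδ, hδ'⟩ := Metric.eventually_nhds_iff.1
    ((tendsto_add_smul (p + s • e) e).eventually (hl.2 _ hsC hls))
  have hfree : ∀ r, s < r → r < s + δ → p + r • e ∉ flatSet d C := fun r h1 h2 => by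
    have := hδ' (y := r - s) (by
      rw [Real.dist_eq, sub_zero, abs_of_pos (sub_pos.2 h1)]
      linarith) (by
      rw [map_add, hls, zero_add, map_smul]
      exact mul_pos (sub_pos.2 h1) hle)
    rwa [show p + s • e + (r - s) • e = p + r • e by module] at this
  have htδ : s + δ ≤ t := by
    by_contra! h1
    exact hfree t hst h1 htX
  obtain ⟨r, ⟨hr, hrX⟩, hmin⟩ := (isCompact_covered h (p := p) (e := e) (s := s + δ) (t := t)
    fun r hr => (hη r t (habs r ⟨by linarith [hr.1], hr.2⟩) ht).1).exists_isLeast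
    ⟨t, ⟨htδ, le_rfl⟩, htX⟩
  have hrs : |r| < η := habs r ⟨by linarith [hr.1], hr.2⟩
  obtain ⟨hrC, q, hq, hqr⟩ := hrX
  refine h.false_of_gap hR (by linarith [hr.1]) hl.1 hq hle.ne' hls hqr hrC
    ((hη s r hs hrs).2 l q hls hqr) fun w h1 h2 hw => ?_
  rcases lt_or_ge w (s + δ) with h3 | h3
  · exact hfree w h1 h3 hw
  · exact h2.not_ge (hmin ⟨⟨h3, h2.le.trans hr.2⟩, hw⟩)

end OneSidedFlat

/-- A flat isolated on one side has a nontrivial stabilizer. -/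
theorem OneSidedFlat.exists_stabilizer [FiniteDimensional ℝ V] (h : IsDividedCone d C m Γ)
    (hl : OneSidedFlat d C l) : ∃ g ∈ Γ, g ≠ 1 ∧ ∀ z, l (g z) = 0 ↔ l z = 0 := by
  have hC := h.proper
  obtain ⟨K, hKC, hK, hcov⟩ := h.divides.cocompact
  obtain ⟨R, hR1, hR⟩ := h.exists_not_closeAt
  obtain ⟨u, hu, hum⟩ := hl.1.exists_basis hC
  obtain ⟨a, ha, hla⟩ := hl.1.exists_mem
  have hd := h.three_le
  let i : Fin d := ⟨0, by omega⟩
  have hy : ∀ n : ℕ, a + (n : ℝ) • u i ∈ C := fun n => by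
    rw [add_comm]
    exact hC.add_mem_of_closure (hC.closure_smul n.cast_nonneg (hu.basis_mem_closure i)) ha
  have hly : ∀ n : ℕ, l (a + (n : ℝ) • u i) = 0 := fun n => by simp [hla, hu.apply_eq_zero]
  choose γ hγ s hs hsK using fun n => hcov _ (hy n)
  choose k hk hk1 hkl using fun n => (hl.pullForm h.divides (Γ.inv_mem (hγ n))).exists_unit
  obtain ⟨k₀, hk₀, φ, hφ, hlim⟩ := hK.tendsto_subseq hsK
  obtain ⟨ψ, q, hψ, hq, -, hqf, hqk⟩ := h.exists_tendsto_flatForm (l := k ∘ φ)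
    (fun n => (hk _).1) (fun n => hk1 _) hlim (hKC hk₀) fun n => by
      rw [Function.comp_apply, hkl, Function.comp_apply, map_smul, pullForm_inv_apply, hly,
        smul_zero]
  obtain ⟨e, he⟩ : ∃ e, 0 < q e := by
    obtain ⟨e, he⟩ := hqf.exists_apply_ne_zero
    rcases he.lt_or_gt with h0 | h0
    · exact ⟨-e, by simpa using h0⟩
    · exact ⟨e, h0⟩
  obtain ⟨η, hη, hclose⟩ := hC.exists_pos_closeAt (hKC hk₀) e hR1
  have hlim' := hlim.comp hψ.tendsto_atTop
  have hqe : Tendsto (fun n => k (φ (ψ n)) e) atTop (nhds (q e)) :=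
    ((ContinuousLinearMap.apply ℝ ℝ e).continuous.tendsto q).comp hq
  obtain ⟨N, hN⟩ := eventually_atTop.1 ((hlim'.eventually
    (h.eventually_crossing hqf (hKC hk₀) (hKC hk₀) hqk hqk he.ne' hη)).and
    (hqe.eventually (lt_mem_nhds he)))
  have hcr : ∀ n ≥ N, ∃ t : ℝ, |t| < η ∧ k₀ + t • e ∈ C ∧ k (φ (ψ n)) (k₀ + t • e) = 0 :=
    fun n hn => (hN n hn).1 _ (hk _).1 (by
      rw [Function.comp_apply, Function.comp_apply, hkl, map_smul, pullForm_inv_apply, hly,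
        smul_zero])
  choose! t ht htC htk using hcr
  have hle : ∀ n ≥ N, ∀ n' ≥ N, t n' ≤ t n := fun n hn n' hn' =>
    (hk (φ (ψ n))).le_of_close h hR hclose (ht n hn) (ht n' hn') (hN n hn).2 (htk n hn)
      ⟨htC n' hn', _, (hk _).1, htk n' hn'⟩
  have hker : ∀ n ≥ N, ∀ w, l ((γ (φ (ψ n)))⁻¹ w) = 0 ↔ l ((γ (φ (ψ N)))⁻¹ w) = 0 := by
    intro n hn w
    have h1 := htk n hn
    rw [le_antisymm (hle N le_rfl n hn) (hle n hn N le_rfl)] at h1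
    have h2 := h.ker_eq_of_common (hk _).1 (hk _).1 (subset_closure (htC N le_rfl))
      (hC.ne_zero (htC N le_rfl)) h1 (htk N le_rfl) w
    rwa [hkl, hkl] at h2
  by_contra! hcon
  have hγN : ∀ n ≥ N, γ (φ (ψ n)) = γ (φ (ψ N)) := by
    intro n hn
    by_contra hne
    obtain ⟨z, hz⟩ := hcon ((γ (φ (ψ n)))⁻¹ * γ (φ (ψ N)))
      (Γ.mul_mem (Γ.inv_mem (hγ _)) (hγ _)) fun h0 => hne (inv_mul_eq_one.1 h0)
    have h1 := hker n hn (γ (φ (ψ N)) z)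
    rw [show (γ (φ (ψ N)))⁻¹ (γ (φ (ψ N)) z) = z from (γ (φ (ψ N))).symm_apply_apply z] at h1
    rcases hz with hz | hz
    · exact hz.2 (h1.1 hz.1)
    · exact hz.1 (h1.2 hz.2)
  set g := γ (φ (ψ N)) with hg
  set w := g.symm k₀ with hw
  have hwC : w ∈ C := h.divides.map_mem g⁻¹ (Γ.inv_mem (hγ _)) k₀ (hKC hk₀)
  have h1 : Tendsto (fun n => s (φ (ψ n)) • (a + (φ (ψ n) : ℝ) • u i)) atTop (nhds w) := by
    have h2 := ((g.symm : V →ₗ[ℝ] V).continuous_of_finiteDimensional.tendsto k₀).comp hlim'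
    refine h2.congr' ?_
    filter_upwards [eventually_ge_atTop N] with n hn
    simp only [Function.comp_apply, hγN n hn]
    rw [← map_smul]
    exact g.symm_apply_apply _
  have h2 := (((m.continuous.tendsto w).comp h1).inv₀ (hC.pos hwC).ne').smul h1
  have h3 := (tendsto_inv_smul_add_smul (hum i) (hC.pos ha)).comp
    (hφ.tendsto_atTop.comp hψ.tendsto_atTop)
  have h4 := tendsto_nhds_unique (h3.congr fun n => ?_) h2
  · exact hu.basis_notMem hd i (h4 ▸ hC.smul_mem _ (inv_pos.2 (hC.pos hwC)) _ hwC)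
  · simp only [Function.comp_apply]
    rw [map_smul, smul_smul, smul_eq_mul, mul_inv, mul_right_comm, inv_mul_cancel₀ (hs _).ne',
      one_mul]

end

section

variable {C : Set V} {m : V →L[ℝ] ℝ} {Γ : Subgroup (V ≃ₗ[ℝ] V)} {d : ℕ} {l l' : V →L[ℝ] ℝ}

/-- No nontrivial element maps the set of points of a flat close to a disjoint flat to itself. -/
theorem IsDividedCone.eq_one_of_forall_closeAt [FiniteDimensional ℝ V] (h : IsDividedCone d C m Γ)
    (hl : IsFlatForm d C l) (hl' : IsFlatForm d C l') (hdisj : ∀ y ∈ C, l y = 0 → l' y ≠ 0)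
    {R : ℝ} {x : V} (hx : CloseAt C R l l' x) {g : V ≃ₗ[ℝ] V} (hg : g ∈ Γ)
    (hmap : ∀ y, CloseAt C R l l' y → CloseAt C R l l' (g y)) : g = 1 := by
  have hC := h.proper
  let K : Set V := {y | m y = 1 ∧ CloseAt C R l l' y}
  have hK : IsCompact K := IsSeqCompact.isCompact fun y hy => by
    obtain ⟨φ, y₀, hφ, hy₀, h1, h2⟩ := h.exists_tendsto_closeAt hl hl' hdisj
      (tendsto_const_nhds (x := R)) (fun n => (hy n).1) fun n => (hy n).2
    exact ⟨y₀, ⟨h1, h2⟩, φ, hφ, hy₀⟩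
  have hscale : ∀ y, CloseAt C R l l' y → (m y)⁻¹ • y ∈ K := fun y hy =>
    ⟨by rw [map_smul, smul_eq_mul, inv_mul_cancel₀ (hC.pos hy.1).ne'],
      hy.smul hC (inv_pos.2 (hC.pos hy.1))⟩
  obtain ⟨p, hp⟩ : K.Nonempty := ⟨_, hscale x hx⟩
  have hpow : ∀ n : ℕ, CloseAt C R l l' ((g ^ n) p) := by
    intro n
    induction n with
    | zero => exact hp.2
    | succ n ih =>
      rw [pow_succ']
      exact hmap _ ih
  have hfin := h.divides.proper K (fun y hy => hy.2.1) hK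
  have hmem : ∀ n : ℕ, g ^ n ∈ {γ | γ ∈ Γ ∧ ∃ y ∈ K, ∃ s : ℝ, 0 < s ∧ s • γ y ∈ K} := fun n =>
    ⟨Γ.pow_mem hg n, p, hp, _, inv_pos.2 (hC.pos (hpow n).1), hscale _ (hpow n)⟩
  obtain ⟨i, -, j, -, hij, he⟩ := infinite_univ.exists_ne_map_eq_of_mapsTo
    (fun n _ => hmem n) hfin
  wlog hlt : i < j generalizing i j
  · exact this j i hij.symm he.symm (lt_of_le_of_ne (not_lt.1 hlt) hij.symm)
  refine h.divides.torsionFree g hg (j - i) (by omega) ?_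
  rw [pow_sub g hlt.le, ← he, mul_inv_cancel]

/-- A flat which separates two disjoint flats is closer to the first one than the second is. -/
theorem IsDividedCone.closeAt_of_between [FiniteDimensional ℝ V] (h : IsDividedCone d C m Γ)
    (hl : IsFlatForm d C l) (hl' : IsFlatForm d C l') {q : V →L[ℝ] ℝ} (hq : IsFlatForm d C q)
    {a e : V} (ha : a ∈ C) (hla : l a = 0) (hqa : q a ≠ 0) {s t : ℝ} (hst : s ≤ t) (ht : t < 0)
    (hs : a + s • e ∈ C) (hls : l' (a + s • e) = 0) (hqt : q (a + t • e) = 0) {R : ℝ}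
    (hR : 1 ≤ R) {x : V} (hx : CloseAt C R l l' x) : CloseAt C R l q x := by
  have hC := h.proper
  obtain ⟨hxC, hlx, y, hy, hly, h1, h2⟩ := hx
  by_cases hqy : q y = 0
  · exact ⟨hxC, hlx, y, hy, hqy, h1, h2⟩
  have h3 := h.mul_pos_of_ne hq hl ha hxC hla hlx hqa
  have h4 := h.mul_pos_of_ne hq hl' hy hs hly hls hqy
  have h5 : q a * q (a + s • e) ≤ 0 := by
    simp only [map_add, map_smul, smul_eq_mul] at hqt ⊢
    have : t * (q a * (q a + s * q e)) = (t - s) * (q a * q a) := by linear_combination s * q a * hqt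
    have h6 : 0 ≤ (t - s) * (q a * q a) := mul_nonneg (by linarith) (mul_self_nonneg _)
    by_contra! h7
    nlinarith
  have h6 : q x * q y < 0 := by
    have h7 : q x * q y ≠ 0 := mul_ne_zero (fun h0 => by simp [h0] at h3) hqy
    refine lt_of_le_of_ne ?_ h7
    by_contra! h8
    have := mul_pos (mul_pos h3 h4) h8
    nlinarith [mul_self_nonneg (q x * q y)]
  obtain ⟨r, hr0, hr1, hr⟩ := exists_combo_eq_zero h6
  refine ⟨hxC, hlx, (1 - r) • x + r • y, hC.combo_mem hxC hy hr0.le hr1.le, by simpa using hr,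
    ?_, ?_⟩
  · convert hC.closure_smul hr0.le h1 using 1
    module
  · convert hC.closure_add (hC.closure_smul (mul_nonneg (sub_nonneg.2 hr1.le) (sub_nonneg.2 hR))
      (subset_closure hxC)) (hC.closure_smul hr0.le h2) using 1
    module

theorem IsProperCone.exists_closeAt (hC : IsProperCone C m) {a y : V} (ha : a ∈ C) (hy : y ∈ C)
    (hla : l a = 0) (hly : l' y = 0) : ∃ R : ℝ, 1 ≤ R ∧ CloseAt C R l l' a := by
  have key : ∀ x ∈ C, ∀ z : V, ∃ s : ℝ, 0 < s ∧ s • x - z ∈ C := by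
    intro x hx z
    obtain ⟨ε, hε, h1⟩ := hC.exists_pos_forall_add_smul_mem hx (-z)
    refine ⟨(ε / 2)⁻¹, by positivity, ?_⟩
    convert hC.smul_mem (ε / 2)⁻¹ (by positivity) _
      (h1 (ε / 2) (by rw [abs_of_pos (by positivity)]; linarith)) using 1
    rw [smul_add, smul_smul, inv_mul_cancel₀ (by positivity), one_smul, sub_eq_add_neg]
  obtain ⟨s, hs, h1⟩ := key y hy a
  obtain ⟨R, hR, h2⟩ := key a ha (s • y)
  have h3 : CloseAt C R l l' a := ⟨ha, hla, s • y, hC.smul_mem s hs y hy, by simp [hly],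
    subset_closure h1, subset_closure h2⟩
  exact ⟨max 1 R, le_max_left _ _, h3.mono hC (le_max_right _ _)⟩

/-- A flat isolated on one side is isolated. -/
theorem OneSidedFlat.eventually [FiniteDimensional ℝ V] (h : IsDividedCone d C m Γ)
    (hl : OneSidedFlat d C l) {a : V} (ha : a ∈ C) (hla : l a = 0) :
    ∀ᶠ y in nhds a, y ∈ flatSet d C → l y = 0 := by
  have hC := h.proper
  by_contra hcon
  obtain ⟨g, hg, hg1, hgl⟩ := hl.exists_stabilizer h
  obtain ⟨e, he⟩ : ∃ e, 0 < l e := by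
    obtain ⟨e, he⟩ := hl.1.exists_apply_ne_zero
    rcases he.lt_or_gt with h0 | h0
    · exact ⟨-e, by simpa using h0⟩
    · exact ⟨e, h0⟩
  have hgl' : ∀ z, l (g⁻¹ z) = 0 ↔ l z = 0 := fun z => by
    rw [← hgl (g⁻¹ z), show g (g⁻¹ z) = z from g.apply_symm_apply z]
  have hga : g a ∈ C := h.divides.map_mem g hg a ha
  obtain ⟨η, hη, hη'⟩ := Metric.eventually_nhds_iff.1
    ((tendsto_add_smul a e).eventually (hl.2 a ha hla))
  have hcr := h.eventually_crossing hl.1 ha ha hla hla he.ne' hη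
  have hcrg := ((g : V →ₗ[ℝ] V).continuous_of_finiteDimensional.tendsto a).eventually
    (h.eventually_crossing hl.1 ha hga hla ((hgl a).2 hla) he.ne' hη)
  obtain ⟨y, hy, hyQ, hygQ⟩ := ((not_eventually.1 hcon).and_eventually (hcr.and hcrg)).exists
  push Not at hy
  obtain ⟨⟨hyC, q, hq, hqy⟩, hly⟩ := hy
  have hdisj : ∀ z ∈ C, l z = 0 → q z ≠ 0 := fun z hz h1 h2 =>
    hly ((h.ker_eq_of_common hl.1 hq (subset_closure hz) (hC.ne_zero hz) h1 h2 y).2 hqy)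
  have hgq : IsFlatForm d C (_root_.pullForm g⁻¹ q) := hq.pullForm h.divides (Γ.inv_mem hg)
  have hgdisj : ∀ z ∈ C, l z = 0 → _root_.pullForm g⁻¹ q z ≠ 0 := fun z hz h1 =>
    hdisj _ (h.divides.map_mem _ (Γ.inv_mem hg) z hz) ((hgl' z).2 h1)
  obtain ⟨s, hs, hsC, hqs⟩ := hyQ q hq hqy
  obtain ⟨t, ht, htC, hqt⟩ := hygQ _ hgq (by
    rw [LinearEquiv.coe_coe, pullForm_inv_apply, hqy])
  have hneg : ∀ (r : ℝ) (f : V →L[ℝ] ℝ), |r| < η → a + r • e ∈ C → IsFlatForm d C f →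
      f (a + r • e) = 0 → f a ≠ 0 → r < 0 := by
    intro r f hr hrC hf hfr hfa
    by_contra! h0
    rcases h0.eq_or_lt with rfl | h0
    · exact hfa (by simpa using hfr)
    · refine hη' (y := r) (by simpa using hr) ?_ ⟨hrC, f, hf, hfr⟩
      rw [map_add, hla, zero_add, map_smul]
      exact mul_pos h0 he
  have hs0 := hneg s q hs hsC hq hqs (hdisj a ha hla)
  have ht0 := hneg t _ ht htC hgq hqt (hgdisj a ha hla)
  obtain ⟨R, hR, hclose⟩ := hC.exists_closeAt (l := l) (l' := q) ha hyC hla hqy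
  have hinv : ∀ z, CloseAt C R l (_root_.pullForm g⁻¹ q) (g z) ↔ CloseAt C R l q z := fun z => by
    refine Iff.trans ?_ (CloseAt.pullForm_inv_iff h.divides hg)
    exact ⟨fun h1 => h1.congr (fun w => (hgl' w).2) fun _ => id,
      fun h1 => h1.congr (fun w => (hgl' w).1) fun _ => id⟩
  rcases le_total s t with hst | hst
  · refine hg1 (inv_eq_one.1 (h.eq_one_of_forall_closeAt hl.1 hq hdisj hclose (Γ.inv_mem hg)
      fun z hz => ?_))
    rw [← hinv, show g (g⁻¹ z) = z from g.apply_symm_apply z]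
    exact h.closeAt_of_between hl.1 hq hgq ha hla (hgdisj a ha hla) hst ht0 hsC hqs hqt hR hz
  · refine hg1 (h.eq_one_of_forall_closeAt hl.1 hq hdisj hclose hg fun z hz => ?_)
    exact h.closeAt_of_between hl.1 hgq hq ha hla (hdisj a ha hla) hst hs0 htC hqt hqs hR
      ((hinv z).2 hz)

/-- The point `a` of a flat is a limit of points of other flats. -/
def NonIsolatedAt (d : ℕ) (C : Set V) (a : V) : Prop :=
  a ∈ C ∧ ∃ l, IsFlatForm d C l ∧ l a = 0 ∧ ∃ᶠ y in nhds a, y ∈ flatSet d C ∧ l y ≠ 0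

theorem NonIsolatedAt.of_frequently [FiniteDimensional ℝ V] (h : IsDividedCone d C m Γ) {a : V}
    (ha : a ∈ C) (hfr : ∃ᶠ z in nhds a, NonIsolatedAt d C z) : NonIsolatedAt d C a := by
  obtain ⟨x, hx, hxN⟩ := exists_seq_forall_of_frequently hfr
  obtain ⟨-, l, hl, hla⟩ := h.mem_flatSet_of_tendsto hx ha fun n =>
    ⟨(hxN n).1, (hxN n).2.choose, (hxN n).2.choose_spec.1, (hxN n).2.choose_spec.2.1⟩
  refine ⟨ha, l, hl, hla, fun hcon => hfr ?_⟩
  filter_upwards [eventually_eventually_nhds.2 hcon] with z hz ⟨hzC, k, hk, hkz, hkf⟩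
  by_cases hlz : l z = 0
  · refine hkf ?_
    filter_upwards [hz] with y hy ⟨hyX, hky⟩
    exact hy ⟨hyX, fun h0 => hky ((h.ker_eq_of_common hl hk (subset_closure hzC)
      (h.proper.ne_zero hzC) hlz hkz y).1 h0)⟩
  · exact hz.self_of_nhds ⟨⟨hzC, k, hk, hkz⟩, hlz⟩

/-- If some flat is not isolated, every point lies on a flat. -/
theorem IsDividedCone.mem_flatSet [FiniteDimensional ℝ V] (h : IsDividedCone d C m Γ) {z x : V}
    (hz : NonIsolatedAt d C z) (hx : x ∈ C) : x ∈ flatSet d C := by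
  have hC := h.proper
  by_contra hxX
  have hseg : ∀ s ∈ Icc (0 : ℝ) 1, z + s • (x - z) ∈ C := fun s hs => by
    convert hC.combo_mem hz.1 hx hs.1 hs.2 using 1
    module
  have hcont : Continuous fun s : ℝ => z + s • (x - z) := by fun_prop
  have hcomp : IsCompact {s | s ∈ Icc (0 : ℝ) 1 ∧ NonIsolatedAt d C (z + s • (x - z))} := by
    refine isCompact_Icc.of_isClosed_subset (IsSeqClosed.isClosed fun s s₀ hs hs₀ => ?_)
      fun s hs => hs.1
    have h1 := isClosed_Icc.mem_of_tendsto hs₀ (Eventually.of_forall fun n => (hs n).1)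
    exact ⟨h1, .of_frequently h (hseg _ h1) (((hcont.tendsto s₀).comp hs₀).frequently
      (Frequently.of_forall fun n => (hs n).2))⟩
  obtain ⟨s, ⟨hs, hsN⟩, hmax⟩ := hcomp.exists_isGreatest ⟨0, ⟨le_rfl, zero_le_one⟩, by simpa⟩
  set e := x - z with he
  set a := z + s • e with ha
  have hxa : x = a + (1 - s) • e := by rw [ha, he]; module
  have hs1 : s < 1 := by
    refine lt_of_le_of_ne hs.2 fun h0 => hxX ?_
    rw [hxa, h0, sub_self, zero_smul, add_zero]
    exact ⟨hsN.1, hsN.2.choose, hsN.2.choose_spec.1, hsN.2.choose_spec.2.1⟩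
  have hnot : ∀ t, 0 < t → t ≤ 1 - s → ¬ NonIsolatedAt d C (a + t • e) := fun t h0 h1 h2 => by
    have := hmax (a := s + t) ⟨⟨by linarith [hs.1], by linarith⟩, by
      convert h2 using 1
      rw [ha]
      module⟩
    linarith
  have hne : ∀ (k : V →L[ℝ] ℝ) (t : ℝ), IsFlatForm d C k → k (a + t • e) = 0 → k e ≠ 0 := by
    intro k t hk hkt h0
    refine hxX ⟨hx, k, hk, ?_⟩
    rw [hxa]
    simpa [h0] using hkt
  obtain ⟨haC, l, hl, hla, hlf⟩ := hsN
  obtain ⟨R, hR1, hR⟩ := h.exists_not_closeAt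
  obtain ⟨η, hη, hclose⟩ := hC.exists_pos_closeAt haC e hR1
  have hfree : ∀ t, 0 < t → t < min η (1 - s) → a + t • e ∉ flatSet d C := by
    rintro t ht0 ht ⟨htC, q, hq, hqt⟩
    have htη := ht.trans_le (min_le_left _ _)
    have habs : ∀ r ∈ Icc 0 t, |r| < η := fun r hr => by
      rw [abs_of_nonneg hr.1]
      exact hr.2.trans_lt htη
    have hqe := hne q t hq hqt
    have hiso : ∀ᶠ y in nhds (a + t • e), ¬ (y ∈ flatSet d C ∧ q y ≠ 0) := by
      by_contra hcon
      exact hnot t ht0 (ht.le.trans (min_le_right _ _)) ⟨htC, q, hq, hqt, hcon⟩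
    obtain ⟨δ, hδ, hδ'⟩ := Metric.eventually_nhds_iff.1
      ((tendsto_add_smul (a + t • e) e).eventually hiso)
    have hgap : ∀ r, t - δ < r → r < t → a + r • e ∉ flatSet d C := by
      intro r h1 h2 hrX
      refine hδ' (y := r - t) (by
        rw [Real.dist_eq, sub_zero, abs_of_neg (sub_neg.2 h2)]
        linarith) ⟨?_, ?_⟩
      · convert hrX using 1
        module
      · rw [map_add, hqt, zero_add, map_smul]
        exact mul_ne_zero (by simpa [sub_eq_zero] using h2.ne) hqe
    obtain ⟨r, ⟨hr, hrX⟩, hrmax⟩ := (isCompact_covered h (p := a) (e := e) (s := 0)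
      (t := max 0 (t - δ)) fun r hr => (hclose r 0 (habs r
        ⟨hr.1, hr.2.trans (max_le ht0.le (by linarith))⟩) (by simpa)).1).exists_isGreatest
      ⟨0, ⟨le_rfl, le_max_left _ _⟩, by simpa using ⟨haC, l, hl, hla⟩⟩
    have hrt : r < t := hr.2.trans_lt (max_lt ht0 (by linarith))
    obtain ⟨hrC, k, hk, hkr⟩ := hrX
    refine h.false_of_gap hR hrt hk hq (hne k r hk hkr) hkr hqt htC
      ((hclose r t (habs r ⟨hr.1, hrt.le⟩) (habs t ⟨ht0.le, le_rfl⟩)).2 k q hkr hqt)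
      fun w h1 h2 hw => ?_
    rcases le_or_gt w (max 0 (t - δ)) with h3 | h3
    · exact h1.not_ge (hrmax ⟨⟨hr.1.trans h1.le, h3⟩, hw⟩)
    · exact hgap w ((le_max_right _ _).trans_lt h3) h2 hw
  have hle := hne l 0 hl (by simpa using hla)
  have hmin : 0 < min η (1 - s) := lt_min hη (by linarith)
  obtain ⟨k, hk, hka, hke, hkl⟩ : ∃ k : V →L[ℝ] ℝ, IsFlatForm d C k ∧ k a = 0 ∧ 0 < k e ∧
      ∀ y, k y = 0 → l y = 0 := by
    rcases hle.lt_or_gt with h0 | h0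
    · exact ⟨(-1 : ℝ) • l, hl.smul (by norm_num), by simp [hla], by simpa using h0, by simp⟩
    · exact ⟨l, hl, hla, h0, fun _ => id⟩
  refine hlf ?_
  filter_upwards [(OneSidedFlat.of_line h hk haC hka hke hmin hfree).eventually h haC hka]
    with y hy ⟨hyX, hly⟩
  exact hly (hkl y (hy hyX))

end

section coneOver

variable {d : ℕ} {Ω : Set (Euc d)}

theorem mem_coneOver {p : Euc d × ℝ} : p ∈ coneOver Ω ↔ 0 < p.2 ∧ p.2⁻¹ • p.1 ∈ Ω := by
  constructor
  · rintro ⟨t, ht, x, hx, rfl⟩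
    simpa [ht, smul_smul, ht.ne'] using hx
  · rintro ⟨h0, h⟩
    exact ⟨p.2, h0, _, h, by ext1 <;> simp [smul_smul, h0.ne']⟩

theorem mk_one_mem_coneOver {x : Euc d} : (x, (1 : ℝ)) ∈ coneOver Ω ↔ x ∈ Ω := by
  simp [mem_coneOver]

theorem smul_mem_coneOver {p : Euc d × ℝ} {t : ℝ} (ht : 0 < t) (hp : p ∈ coneOver Ω) :
    t • p ∈ coneOver Ω := by
  obtain ⟨s, hs, x, hx, rfl⟩ := hp
  exact ⟨t * s, mul_pos ht hs, x, hx, by rw [mul_smul]⟩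

theorem continuousOn_dehomogenize :
    ContinuousOn (fun p : Euc d × ℝ => p.2⁻¹ • p.1) {p | 0 < p.2} :=
  (continuousOn_snd.inv₀ fun p (hp : 0 < p.2) => hp.ne').smul continuousOn_fst

theorem isProperCone_coneOver {B : ℝ} (hne : Ω.Nonempty) (hop : IsOpen Ω)
    (hconv : Convex ℝ Ω) (hB : ∀ x ∈ Ω, ‖x‖ ≤ B) :
    IsProperCone (coneOver Ω) (max B 1 • ContinuousLinearMap.snd ℝ (Euc d) ℝ) where
  isOpen := by
    have h := continuousOn_dehomogenize.isOpen_inter_preimage (t := Ω)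
      (isOpen_lt continuous_const (continuous_snd : Continuous fun p : Euc d × ℝ => p.2)) hop
    exact (show coneOver Ω = _ from Set.ext fun _ => mem_coneOver) ▸ h
  nonempty := hne.elim fun _ hx => ⟨_, mk_one_mem_coneOver.2 hx⟩
  add_mem := by
    rintro _ ⟨t, ht, x, hx, rfl⟩ _ ⟨s, hs, y, hy, rfl⟩
    refine mem_coneOver.2 ⟨by simpa using add_pos ht hs, ?_⟩
    have := hconv hx hy (div_pos ht (add_pos ht hs)).le (div_pos hs (add_pos ht hs)).le
      (by field_simp)
    convert this using 1
    simp only [Prod.snd_add, Prod.smul_snd, smul_eq_mul, mul_one, Prod.fst_add, Prod.smul_fst,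
      smul_add, smul_smul, div_eq_inv_mul]
  smul_mem t ht x hx := smul_mem_coneOver ht hx
  zero_notMem h := by simpa using (mem_coneOver.1 h).1
  norm_le := by
    rintro _ ⟨t, ht, x, hx, rfl⟩
    rw [norm_smul, Real.norm_of_nonneg ht.le, Prod.norm_mk, norm_one, map_smul, smul_eq_mul]
    refine mul_le_mul_of_nonneg_left ?_ ht.le
    simpa using max_le_max_right 1 (hB x hx)

theorem closure_of_mem_closure_coneOver {p : Euc d × ℝ} (hp : p ∈ closure (coneOver Ω))
    (h0 : 0 < p.2) : p.2⁻¹ • p.1 ∈ closure Ω :=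
  (continuousOn_dehomogenize.continuousAt ((isOpen_lt continuous_const
    continuous_snd).mem_nhds h0)).continuousWithinAt.mem_closure hp
      fun _ hq => (mem_coneOver.1 hq).2

variable {Γ : Subgroup ((Euc d × ℝ) ≃ₗ[ℝ] (Euc d × ℝ))}

theorem map_mem_coneOver (hdiv : Divides Ω Γ) {γ : (Euc d × ℝ) ≃ₗ[ℝ] (Euc d × ℝ)} (hγ : γ ∈ Γ)
    {p : Euc d × ℝ} (hp : p ∈ coneOver Ω) : γ p ∈ coneOver Ω :=
  hdiv.1 γ hγ ▸ mem_image_of_mem γ hp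

theorem apply_eq_smul_projAct {γ : (Euc d × ℝ) ≃ₗ[ℝ] (Euc d × ℝ)} {x : Euc d}
    (h : γ (x, 1) ∈ coneOver Ω) : γ (x, 1) = (γ (x, 1)).2 • (projAct γ x, (1 : ℝ)) := by
  have h0 := (mem_coneOver.1 h).1
  ext1 <;> simp [projAct, smul_smul, h0.ne']

theorem dividesCone_coneOver (htf : TorsionFreeSub Γ) (hdiv : Divides Ω Γ) :
    DividesCone (coneOver Ω) Γ where
  map_mem γ hγ p hp := map_mem_coneOver hdiv hγ hp
  cocompact := by
    obtain ⟨K, hKΩ, hK, hcov⟩ := hdiv.2.2.2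
    refine ⟨(fun x => (x, (1 : ℝ))) '' K, ?_, hK.image (by fun_prop), ?_⟩
    · rintro _ ⟨x, hx, rfl⟩
      exact mk_one_mem_coneOver.2 (hKΩ hx)
    · rintro _ ⟨t, ht, x, hx, rfl⟩
      rw [← hcov] at hx
      obtain ⟨γ, hγ, k, hk, rfl⟩ := mem_iUnion₂.1 hx
      have hmem := map_mem_coneOver hdiv hγ (mk_one_mem_coneOver.2 (hKΩ hk))
      have h0 := (mem_coneOver.1 hmem).1
      refine ⟨γ⁻¹, Γ.inv_mem hγ, (γ (k, 1)).2 / t, div_pos h0 ht, k, hk, ?_⟩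
      rw [map_smul, smul_smul, div_mul_cancel₀ _ ht.ne', ← map_smul, ← apply_eq_smul_projAct hmem]
      exact (γ.symm_apply_apply _).symm
  proper K hKC hK := by
    have hpos : K ⊆ {p | 0 < p.2} := fun p hp => (mem_coneOver.1 (hKC hp)).1
    refine (hdiv.2.2.1 ((fun p : Euc d × ℝ => p.2⁻¹ • p.1) '' K) ?_
      (hK.image_of_continuousOn (continuousOn_dehomogenize.mono hpos))).subset ?_
    · rintro _ ⟨p, hp, rfl⟩
      exact (mem_coneOver.1 (hKC hp)).2
    · rintro γ ⟨hγ, p, hp, s, hs, hsp⟩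
      refine ⟨hγ, _, mem_image_of_mem _ (mem_image_of_mem _ hp), s • γ p, hsp, ?_⟩
      have h0 : 0 < p.2 := hpos hp
      have h1 : ((p.2⁻¹ • p.1, (1 : ℝ)) : Euc d × ℝ) = p.2⁻¹ • p := by
        ext1 <;> simp [h0.ne']
      have h2 : 0 < (γ p).2 := (mem_coneOver.1 (map_mem_coneOver hdiv hγ (hKC hp))).1
      simp only [projAct, h1, map_smul, Prod.smul_fst, Prod.smul_snd, smul_eq_mul, smul_smul]
      congr 1
      field_simp
  torsionFree := htf

theorem isDividedCone_coneOver {B : ℝ} (hne : Ω.Nonempty) (hop : IsOpen Ω)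
    (hconv : Convex ℝ Ω) (hB : ∀ x ∈ Ω, ‖x‖ ≤ B) (hd : 3 ≤ d) (hirr : IsIrreducibleDomain Ω)
    (htf : TorsionFreeSub Γ) (hdiv : Divides Ω Γ) :
    IsDividedCone d (coneOver Ω) (max B 1 • ContinuousLinearMap.snd ℝ (Euc d) ℝ) Γ where
  proper := isProperCone_coneOver hne hop hconv hB
  divides := dividesCone_coneOver htf hdiv
  indecomposable := hirr
  three_le := hd
  finrank_eq := by simp

end coneOver

section simplex

variable {ι : Type*} {v : ι → V}

theorem affineIndependent_iff_linearIndependent_mk_one :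
    AffineIndependent ℝ v ↔ LinearIndependent ℝ fun j => (v j, (1 : ℝ)) := by
  rw [affineIndependent_iff, linearIndependent_iff']
  refine forall_congr' fun s => forall_congr' fun w => ?_
  have : ∑ i ∈ s, w i • (v i, (1 : ℝ)) = 0 ↔ ∑ i ∈ s, w i = 0 ∧ ∑ i ∈ s, w i • v i = 0 := by
    rw [Prod.ext_iff, Prod.fst_sum, Prod.snd_sum]
    simp [and_comm]
  rw [this, and_imp]

variable [Fintype ι]

theorem sum_smul_mk_one_eq_iff {w : ι → ℝ} {x : V} :
    ∑ j, w j • (v j, (1 : ℝ)) = (x, 1) ↔ ∑ j, w j = 1 ∧ ∑ j, w j • v j = x := by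
  rw [Prod.ext_iff, Prod.fst_sum, Prod.snd_sum]
  simp [and_comm]

theorem mem_convexHull_range_iff {x : V} : x ∈ convexHull ℝ (range v) ↔
    ∃ w : ι → ℝ, (∀ j, 0 ≤ w j) ∧ ∑ j, w j • (v j, (1 : ℝ)) = (x, 1) := by
  constructor
  · intro hx
    have hc : Convex ℝ {x : V | ∃ w : ι → ℝ, (∀ j, 0 ≤ w j) ∧
        ∑ j, w j • (v j, (1 : ℝ)) = (x, 1)} := by
      rintro x ⟨w, hw, hwx⟩ y ⟨w', hw', hwy⟩ a b ha hb hab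
      refine ⟨fun j => a * w j + b * w' j, fun j => add_nonneg (mul_nonneg ha (hw j))
        (mul_nonneg hb (hw' j)), ?_⟩
      simp_rw [add_smul, mul_smul, Finset.sum_add_distrib, ← Finset.smul_sum, hwx, hwy]
      ext1 <;> simp [hab]
    refine convexHull_min ?_ hc hx
    classical
    rintro _ ⟨i, rfl⟩
    refine ⟨Pi.single i 1, fun j => ?_, ?_⟩
    · exact (Pi.single_nonneg (α := fun _ : ι => ℝ)).2 zero_le_one j
    · simp [Pi.single_apply]
  · rintro ⟨w, hw, h⟩
    obtain ⟨h1, rfl⟩ := sum_smul_mk_one_eq_iff.1 h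
    exact (convex_convexHull ℝ _).sum_mem (fun j _ => hw j) h1
      fun j _ => subset_convexHull ℝ _ (mem_range_self j)

theorem mem_intrinsicInterior_convexHull_range_iff [FiniteDimensional ℝ V]
    (hv : AffineIndependent ℝ v) {x : V} :
    x ∈ intrinsicInterior ℝ (convexHull ℝ (range v)) ↔
      ∃ w : ι → ℝ, (∀ j, 0 < w j) ∧ ∑ j, w j • (v j, (1 : ℝ)) = (x, 1) := by
  obtain ⟨L, hL⟩ := (affineIndependent_iff_linearIndependent_mk_one.1 hv).exists_coords
  have hspan : ∀ y ∈ affineSpan ℝ (convexHull ℝ (range v)),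
      ∑ j, L (y, 1) j • (v j, (1 : ℝ)) = (y, 1) := by
    intro y hy
    rw [affineSpan_convexHull] at hy
    obtain ⟨w, hw1, hw⟩ := eq_affineCombination_of_mem_affineSpan_of_fintype hy
    rw [Finset.affineCombination_eq_linear_combination _ _ _ hw1] at hw
    have := sum_smul_mk_one_eq_iff.2 ⟨hw1, hw.symm⟩
    rw [← this, hL]
  rw [mem_intrinsicInterior]
  constructor
  · rintro ⟨y, hy, rfl⟩
    refine ⟨fun j => L (y, 1) j, fun k => ?_, hspan y y.2⟩
    by_contra! hk
    have hvk : v k ∈ affineSpan ℝ (convexHull ℝ (range v)) := by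
      rw [affineSpan_convexHull]
      exact mem_affineSpan ℝ (mem_range_self k)
    set z : affineSpan ℝ (convexHull ℝ (range v)) := ⟨v k, hvk⟩
    have hcont : Tendsto (fun t : ℝ => AffineMap.lineMap (y : V) (v k) t) (nhds 0) (nhds (y : V)) := by
      have : Continuous fun t : ℝ => AffineMap.lineMap (y : V) (v k) t :=
        AffineMap.lineMap_continuous
      simpa using this.tendsto 0
    have hlift : Tendsto (fun t : ℝ => (⟨AffineMap.lineMap (y : V) (v k) t,
        AffineMap.lineMap_mem t y.2 hvk⟩ : affineSpan ℝ (convexHull ℝ (range v))))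
        (nhds 0) (nhds y) := tendsto_subtype_rng.2 hcont
    have hev := hlift.eventually (isOpen_interior.mem_nhds hy)
    obtain ⟨t, ht, ht0⟩ := ((hev.filter_mono (nhdsWithin_le_nhds (s := Iio 0))).and
      self_mem_nhdsWithin).exists
    have hmem : AffineMap.lineMap (y : V) (v k) t ∈ convexHull ℝ (range v) :=
      interior_subset (s := ((↑) ⁻¹' convexHull ℝ (range v) :
        Set (affineSpan ℝ (convexHull ℝ (range v))))) ht
    obtain ⟨w, hw, hwx⟩ := mem_convexHull_range_iff.1 hmem
    have h1 : ((AffineMap.lineMap (y : V) (v k) t, 1) : V × ℝ) =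
        (1 - t) • ((y : V), (1 : ℝ)) + t • (v k, (1 : ℝ)) := by
      ext1
      · simp [AffineMap.lineMap_apply_module]
      · simp
    classical
    have h2 : L (v k, 1) = Pi.single k 1 := by
      rw [← hL (Pi.single k 1)]
      simp [Pi.single_apply]
    have h3 := hL w
    rw [hwx, h1, map_add, map_smul, map_smul, h2] at h3
    have h4 := congrFun h3 k
    simp only [Pi.add_apply, Pi.smul_apply, smul_eq_mul, Pi.single_eq_same, mul_one] at h4
    have ht0 : t < 0 := ht0
    have := hw k
    nlinarith
  · rintro ⟨w, hw, hwx⟩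
    have hx : x ∈ convexHull ℝ (range v) :=
      mem_convexHull_range_iff.2 ⟨w, fun j => (hw j).le, hwx⟩
    refine ⟨⟨x, subset_affineSpan ℝ _ hx⟩, ?_, rfl⟩
    have hU : IsOpen {y : affineSpan ℝ (convexHull ℝ (range v)) | ∀ j, 0 < L ((y : V), 1) j} := by
      rw [ofPred_forall]
      exact isOpen_iInter_of_finite fun j => isOpen_lt continuous_const (by fun_prop)
    refine interior_maximal (fun y hy => ?_) hU (show ∀ j, 0 < L (x, 1) j from fun j => ?_)
    · exact mem_convexHull_range_iff.2 ⟨_, fun j => (hy j).le, hspan y y.2⟩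
    · rw [← hwx, hL]
      exact hw j

end simplex

section flats

variable {d : ℕ} {Ω : Set (Euc d)} {l : (Euc d × ℝ) →L[ℝ] ℝ} {v : Fin d → Euc d}

theorem IsFlatFormWith.mem_intrinsicInterior_iff
    (h : IsFlatFormWith (coneOver Ω) l fun j => (v j, (1 : ℝ))) {x : Euc d} :
    x ∈ intrinsicInterior ℝ (convexHull ℝ (range v)) ↔ x ∈ Ω ∧ l (x, 1) = 0 := by
  rw [mem_intrinsicInterior_convexHull_range_iff
    (affineIndependent_iff_linearIndependent_mk_one.2 h.2.1), ← mk_one_mem_coneOver, h.2.2]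
  simp only [eq_comm]

theorem IsFlatFormWith.isFlatWith (hd : 3 ≤ d)
    (h : IsFlatFormWith (coneOver Ω) l fun j => (v j, (1 : ℝ))) : IsFlatWith Ω v := by
  have hcl : ∀ x : Euc d, ((x, 1) : Euc d × ℝ) ∈ closure (coneOver Ω) → x ∈ closure Ω :=
    fun x hx => by simpa using closure_of_mem_closure_coneOver hx (by simp)
  refine ⟨affineIndependent_iff_linearIndependent_mk_one.2 h.2.1, fun j =>
    ⟨hcl _ (h.basis_mem_closure j), fun hj => h.basis_notMem hd j (mk_one_mem_coneOver.2 hj)⟩,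
    fun x hx => (h.mem_intrinsicInterior_iff.1 hx).1, ?_⟩
  rintro x ⟨hx, hxF⟩
  obtain ⟨w, hw, hwx⟩ := mem_convexHull_range_iff.1 hx
  refine ⟨hcl _ (hwx ▸ h.mem_closure hw), fun hxΩ => hxF (h.mem_intrinsicInterior_iff.2 ⟨hxΩ, ?_⟩)⟩
  rw [← hwx]
  exact h.apply_sum' w

theorem IsFlatWith.exists_isFlatFormWith (hd : 0 < d) (hconv : Convex ℝ Ω)
    (hv : IsFlatWith Ω v) :
    ∃ l, IsFlatFormWith (coneOver Ω) l fun j => (v j, (1 : ℝ)) := by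
  obtain ⟨hind, -, hsub, hbdry⟩ := hv
  have hlin := affineIndependent_iff_linearIndependent_mk_one.1 hind
  have hlt : Submodule.span ℝ (range fun j => (v j, (1 : ℝ))) < ⊤ := by
    refine lt_top_iff_ne_top.2 fun htop => ?_
    have h1 := finrank_span_eq_card hlin
    rw [htop] at h1
    simp at h1
  obtain ⟨f, hf0, hf⟩ := Submodule.exists_le_ker_of_lt_top _ hlt
  set l : (Euc d × ℝ) →L[ℝ] ℝ := LinearMap.toContinuousLinearMap f
  have hl0 : l ≠ 0 := fun h0 => hf0 
    (LinearMap.toContinuousLinearMap.injective (h0.trans (map_zero _).symm))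
  have hlv : ∀ j, l (v j, 1) = 0 := fun j => hf (Submodule.subset_span (mem_range_self j))
  refine ⟨l, hl0, hlin, fun z => ⟨?_, ?_⟩⟩
  · rintro ⟨⟨t, ht, x, hx, rfl⟩, hlx⟩
    rw [map_smul, smul_eq_zero_iff_right ht.ne'] at hlx
    obtain ⟨w, hw⟩ := exists_eq_sum_of_ker (by simp) hl0 hlin hlv hlx
    refine ⟨fun j => t * w j, ?_, by simp_rw [mul_smul, ← Finset.smul_sum, ← hw]⟩
    by_contra! hneg
    have : Nonempty (Fin d) := ⟨⟨0, hd⟩⟩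
    obtain ⟨i, hi⟩ := Finite.exists_min w
    have hi0 : w i ≤ 0 := by
      obtain ⟨j, hj⟩ := hneg
      exact (hi j).trans (nonpos_of_mul_nonpos_right hj ht)
    set a : ℝ := (d : ℝ)⁻¹ with ha_def
    have ha : 0 < a := by positivity
    have hD : 0 < a - w i := by linarith
    have hg : ∑ j, a • (v j, (1 : ℝ)) = (∑ j, a • v j, 1) :=
      sum_smul_mk_one_eq_iff.2 ⟨by simp [a, hd.ne'], rfl⟩
    have hgΩ := hsub ((mem_intrinsicInterior_convexHull_range_iff hind).2 ⟨_, fun _ => ha, hg⟩)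
    have hyΩ := hconv hgΩ hx (a := -w i / (a - w i)) (b := a / (a - w i))
      (div_nonneg (by linarith) hD.le) (by positivity) (by field_simp; ring)
    have hy : ∑ j, (a * (w j - w i) / (a - w i)) • (v j, (1 : ℝ)) =
        ((-w i / (a - w i)) • ∑ j, a • v j + (a / (a - w i)) • x, 1) := by
      have h1 : (((-w i / (a - w i)) • ∑ j, a • v j + (a / (a - w i)) • x, 1) : Euc d × ℝ) =
          (-w i / (a - w i)) • (∑ j, a • v j, (1 : ℝ)) + (a / (a - w i)) • (x, (1 : ℝ)) := by
        ext1
        · simp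
        · simp
          field_simp
          ring
      rw [h1, ← hg, hw, Finset.smul_sum, Finset.smul_sum, ← Finset.sum_add_distrib]
      refine Finset.sum_congr rfl fun j _ => ?_
      rw [smul_smul, smul_smul, ← add_smul]
      congr 1
      ring
    refine (hbdry ⟨mem_convexHull_range_iff.2 ⟨_, fun j => ?_, hy⟩, fun hyF => ?_⟩).2 hyΩ
    · exact div_nonneg (mul_nonneg ha.le (sub_nonneg.2 (hi j))) hD.le
    · obtain ⟨c, hc, hcy⟩ := (mem_intrinsicInterior_convexHull_range_iff hind).1 hyF
      have := congrFun (hlin.fintypeLinearCombination_injective (hcy.trans hy.symm)) i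
      have hci := hc i
      simp only [sub_self, mul_zero, zero_div] at this
      exact hci.ne' this
  · rintro ⟨c, hc, rfl⟩
    have : Nonempty (Fin d) := ⟨⟨0, hd⟩⟩
    have hT : 0 < ∑ j, c j := Finset.sum_pos (fun j _ => hc j) Finset.univ_nonempty
    refine ⟨?_, by simp only [map_sum, map_smul, hlv, smul_zero, Finset.sum_const_zero]⟩
    have h1 : ∑ j, (c j / ∑ k, c k) • (v j, (1 : ℝ)) = (∑ j, (c j / ∑ k, c k) • v j, 1) :=
      sum_smul_mk_one_eq_iff.2 ⟨by rw [← Finset.sum_div, div_self hT.ne'], rfl⟩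
    have h2 := hsub ((mem_intrinsicInterior_convexHull_range_iff hind).2
      ⟨_, fun j => div_pos (hc j) hT, h1⟩)
    have h3 := smul_mem_coneOver hT (mk_one_mem_coneOver.2 h2)
    rw [← h1, Finset.smul_sum] at h3
    simpa only [smul_smul, mul_div_cancel₀ _ hT.ne'] using h3

theorem IsFlat.exists_isFlatForm (hd : 0 < d) (hconv : Convex ℝ Ω) {F : Set (Euc d)}
    (hF : IsFlat Ω F) : ∃ l, IsFlatForm d (coneOver Ω) l ∧ F = {x | x ∈ Ω ∧ l (x, 1) = 0} := by
  obtain ⟨v, hv, rfl⟩ := hF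
  obtain ⟨l, hl⟩ := hv.exists_isFlatFormWith hd hconv
  exact ⟨l, ⟨_, hl⟩, Set.ext fun x => hl.mem_intrinsicInterior_iff⟩

theorem IsFlatForm.exists_isFlat {c : ℝ} (hc : 0 < c)
    (hC : IsProperCone (coneOver Ω) (c • ContinuousLinearMap.snd ℝ (Euc d) ℝ)) (hd : 3 ≤ d)
    (hl : IsFlatForm d (coneOver Ω) l) {x : Euc d} (hx : x ∈ Ω) (hlx : l (x, 1) = 0) :
    ∃ F, IsFlat Ω F ∧ x ∈ F := by
  obtain ⟨u, hu, hu1⟩ := hl.exists_basis hC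
  have hcu : ∀ j, c • u j = (c • (u j).1, (1 : ℝ)) := fun j => by
    ext1
    · simp
    · simpa using hu1 j
  have hv : IsFlatFormWith (coneOver Ω) l fun j => (c • (u j).1, (1 : ℝ)) := by
    simp_rw [← hcu]
    refine ⟨hu.1, hu.2.1.units_smul fun _ => Units.mk0 c hc.ne', fun z => (hu.2.2 z).trans
      ⟨?_, ?_⟩⟩
    · rintro ⟨w, hw, rfl⟩
      exact ⟨fun j => w j / c, fun j => div_pos (hw j) hc, by
        simp only [smul_smul, div_mul_cancel₀ _ hc.ne']⟩
    · rintro ⟨w, hw, rfl⟩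
      exact ⟨fun j => w j * c, fun j => mul_pos (hw j) hc, by simp only [smul_smul]⟩
  exact ⟨_, ⟨_, hv.isFlatWith hd, rfl⟩, hv.mem_intrinsicInterior_iff.2 ⟨hx, hlx⟩⟩

theorem exists_nonIsolatedAt {m : (Euc d × ℝ) →L[ℝ] ℝ}
    {Γ : Subgroup ((Euc d × ℝ) ≃ₗ[ℝ] (Euc d × ℝ))} (h : IsDividedCone d (coneOver Ω) m Γ)
    (hbd : Bornology.IsBounded Ω) (hconv : Convex ℝ Ω) {F : Set (Euc d)} (hF : IsFlat Ω F)
    (hiso : ¬ IsIsolatedFlat Ω F) : ∃ z, NonIsolatedAt d (coneOver Ω) z := by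
  have hd : 0 < d := by have := h.three_le; omega
  have hflat_ne : ∀ {F}, IsFlat Ω F → F.Nonempty := fun {F} hF => by
    obtain ⟨v, hv, rfl⟩ := hF
    have : Nonempty (Fin d) := ⟨⟨0, hd⟩⟩
    rw [intrinsicInterior_nonempty (convex_convexHull ℝ _), convexHull_nonempty_iff]
    exact range_nonempty v
  obtain ⟨Fs, hFs, hne, hlim⟩ := not_not.1 hiso
  obtain ⟨l, hl, hFl⟩ := hF.exists_isFlatForm hd hconv
  obtain ⟨x, hx⟩ := hflat_ne hF
  have hxl : x ∈ Ω ∧ l (x, 1) = 0 := hFl.subset hx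
  refine ⟨(x, 1), mk_one_mem_coneOver.2 hxl.1, l, hl, hxl.2, ?_⟩
  rw [(nhds_basis_ball (x := ((x, 1) : Euc d × ℝ))).frequently_iff]
  intro ε hε
  obtain ⟨n, hn⟩ := (hlim.eventually (gt_mem_nhds hε)).exists
  have hsub : ∀ {F}, IsFlat Ω F → F ⊆ Ω := fun {F} hF => by
    obtain ⟨v, hv, rfl⟩ := hF
    exact hv.2.2.1
  obtain ⟨y, hy, hyx⟩ := exists_dist_lt_of_hausdorffDist_lt' (subset_closure hx) hn
    (hausdorffEDist_ne_top_of_nonempty_of_bounded (hflat_ne (hFs n)).closure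
      (hflat_ne hF).closure (hbd.subset (hsub (hFs n))).closure (hbd.subset (hsub hF)).closure)
  obtain ⟨y', hy', hyy'⟩ := Metric.mem_closure_iff.1 hy (ε - dist y x) (by linarith)
  obtain ⟨k, hk, hFk⟩ := (hFs n).exists_isFlatForm hd hconv
  have hyk : y' ∈ Ω ∧ k (y', 1) = 0 := hFk.subset hy'
  have hyC := mk_one_mem_coneOver.2 hyk.1
  refine ⟨(y', 1), ?_, ⟨hyC, k, hk, hyk.2⟩, fun h0 => hne n ?_⟩
  · rw [mem_ball, Prod.dist_eq, dist_self, max_eq_left dist_nonneg]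
    have := dist_triangle_left y' x y
    linarith
  · have := h.ker_eq_of_common hk hl (subset_closure hyC) (h.proper.ne_zero hyC) hyk.2 h0
    rw [hFk, hFl]
    simp only [this]

end flats

end ConeGeometry

theorem nonisolated_flat_implies_foliated {d : ℕ} (Ω : Set (Euc d)) (hne : Ω.Nonempty)
    (hbd : Bornology.IsBounded Ω) (hop : IsOpen Ω) (hconv : Convex ℝ Ω)
    (hd : 3 ≤ d) (hirr : IsIrreducibleDomain Ω)
    (Γ : Subgroup ((Euc d × ℝ) ≃ₗ[ℝ] (Euc d × ℝ)))
    (htf : TorsionFreeSub Γ) (hdiv : Divides Ω Γ)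
    (hex : ∃ F : Set (Euc d), IsFlat Ω F ∧ ¬ IsIsolatedFlat Ω F) :
    ∀ x ∈ Ω, ∃ F : Set (Euc d), IsFlat Ω F ∧ x ∈ F := by
  intro x hx
  obtain ⟨B, hB⟩ := hbd.exists_norm_le
  have h := isDividedCone_coneOver hne hop hconv hB hd hirr htf hdiv
  obtain ⟨F, hF, hiso⟩ := hex
  obtain ⟨z, hz⟩ := exists_nonIsolatedAt h hbd hconv hF hiso
  obtain ⟨-, l, hl, hlx⟩ := h.mem_flatSet hz (mk_one_mem_coneOver.2 hx)
  exact hl.exists_isFlat (by positivity) h.proper hd hx hlx
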